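/- arXiv:1405.6008 — 4 statements merged into one kernel-verified Lean document; each statement's English description precedes it below -/
import Mathlib

section
/- Let E and Ê be sets of points of the Hermitian curve with |E| ≤ |Ê|. Let Λ (respectively Λ̂) be a nonzero polynomial in F[x, y] with deg_y ≤ q − 1, vanishing at every point of E (respectively Ê), and of minimal weighted degree among all such polynomials. If deg_{q,q+1}(Λ̂) ≤ deg_{q,q+1}(Λ), then 0 ≤ |Ê| − |E| ≤ g. -/
open MvPolynomial in
theorem herm_weight (q : ℕ) (s : Fin 2 →₀ ℕ) :
    Finsupp.weight ![q, q + 1] s = s 0 * q + s 1 * (q + 1) := by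
  rw [Finsupp.weight_apply, Finsupp.sum_fintype _ _ (by simp)]
  simp [Fin.sum_univ_two]

theorem herm_gap_card (q N : ℕ) (hq : 0 < q) :
    N + 1 ≤ ((Finset.range (N + 1)).filter (fun n => (q + 1) * (n % q) ≤ n)).card
      + q * (q - 1) / 2 := by
  have h1 := Finset.card_filter_add_card_filter_not (s := Finset.range (N + 1))
    (fun n => (q + 1) * (n % q) ≤ n)
  have h2 : ((Finset.range (N + 1)).filter (fun n => ¬ (q + 1) * (n % q) ≤ n)).card
      ≤ q * (q - 1) / 2 := by
    have h3 : ((Finset.range q).sigma (fun j => Finset.range j)).card = q * (q - 1) / 2 := by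
      rw [Finset.card_sigma]
      simp [Finset.sum_range_id]
    rw [← h3]
    refine Finset.card_le_card_of_surjOn (fun a => a.1 + q * a.2) ?_
    intro n hn
    simp only [Finset.coe_filter, Set.mem_ofPred_eq, not_le] at hn
    refine ⟨⟨n % q, n / q⟩, ?_, ?_⟩
    · simp only [Finset.coe_sigma, Set.mem_sigma_iff, Finset.coe_range, Set.mem_Iio]
      refine ⟨Nat.mod_lt _ hq, ?_⟩
      have := Nat.mod_add_div n q
      by_contra hc
      push Not at hc
      have := Nat.mul_le_mul_left q hc
      nlinarith
    · exact Nat.mod_add_div n q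
  simp only [Finset.card_range] at h1
  omega

open MvPolynomial in
theorem herm_exists {F : Type} [Field F] [Fintype F] (q : ℕ) (hq : 0 < q) (E : Set (F × F)) :
    ∃ μ : MvPolynomial (Fin 2) F, μ ≠ 0 ∧ degreeOf 1 μ ≤ q - 1 ∧
      (∀ P ∈ E, eval ![P.1, P.2] μ = 0) ∧
      weightedTotalDegree ![q, q + 1] μ ≤ E.ncard + q * (q - 1) / 2 := by
  classical
  set N := E.ncard + q * (q - 1) / 2 with hN
  set I := (Finset.range (N + 1)).filter (fun n => (q + 1) * (n % q) ≤ n) with hI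
  have hIc := herm_gap_card q N hq
  rw [← hI] at hIc
  let s : ℕ → (Fin 2 →₀ ℕ) := fun n =>
    Finsupp.single 0 ((n - (q + 1) * (n % q)) / q) + Finsupp.single 1 (n % q)
  have s0 : ∀ n, s n 0 = (n - (q + 1) * (n % q)) / q := by intro n; simp [s]
  have s1 : ∀ n, s n 1 = n % q := by intro n; simp [s]
  have hw : ∀ n ∈ I, Finsupp.weight ![q, q + 1] (s n) = n := by
    intro n hn
    rw [herm_weight, s0, s1]
    simp only [hI, Finset.mem_filter] at hn
    have h1 := Nat.mod_add_div n q
    have hd : q ∣ n - (q + 1) * (n % q) := by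
      have : n - (q + 1) * (n % q) = q * (n / q) - q * (n % q) := by
        rw [add_mul]; omega
      rw [this, ← Nat.mul_sub]
      exact dvd_mul_right _ _
    rw [Nat.div_mul_cancel hd, mul_comm (n % q)]
    omega
  let M : (I → F) →ₗ[F] MvPolynomial (Fin 2) F :=
    ∑ n : I, (monomial (s n)).comp (LinearMap.proj n)
  have hM : ∀ c, M c = ∑ n : I, monomial (s n) (c n) := by
    intro c; simp [M]
  let ev : MvPolynomial (Fin 2) F →ₗ[F] (E → F) :=
    LinearMap.pi (fun P => (aeval (R := F) ![P.1.1, P.1.2]).toLinearMap)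
  have hker : LinearMap.ker (ev.comp M) ≠ ⊥ := by
    apply LinearMap.ker_ne_bot_of_finrank_lt
    rw [Module.finrank_fintype_fun_eq_card, Module.finrank_fintype_fun_eq_card,
      Fintype.card_coe, ← Nat.card_eq_fintype_card, Nat.card_coe_set_eq]
    omega
  obtain ⟨c, hc, hc0⟩ := (Submodule.ne_bot_iff _).1 hker
  have hsupp : ∀ t ∈ (M c).support, ∃ n ∈ I, s n = t := by
    intro t ht
    rw [hM] at ht
    have := support_sum ht
    simp only [Finset.mem_biUnion, Finset.mem_univ, true_and] at this
    obtain ⟨n, hn⟩ := this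
    exact ⟨n, n.2, (Finset.mem_singleton.1 (support_monomial_subset hn)).symm⟩
  refine ⟨M c, ?_, ?_, ?_, ?_⟩
  · intro h0
    apply hc0
    funext n
    have h1 : coeff (s n) (M c) = c n := by
      rw [hM, coeff_sum, Finset.sum_eq_single n]
      · simp
      · intro m _ hmn
        rw [coeff_monomial, if_neg]
        intro h
        apply hmn
        have := congrArg (Finsupp.weight ![q, q + 1]) h
        rw [hw _ m.2, hw _ n.2] at this
        exact Subtype.ext this
      · simp
    rw [← h1, h0]; simp
  · rw [degreeOf_le_iff]
    intro t ht
    obtain ⟨n, hn, rfl⟩ := hsupp t ht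
    rw [s1]
    have := Nat.mod_lt n hq
    omega
  · intro P hP
    have := congrFun (LinearMap.mem_ker.1 hc) ⟨P, hP⟩
    simpa [ev, aeval_eq_eval] using this
  · unfold weightedTotalDegree
    apply Finset.sup_le
    intro t ht
    obtain ⟨n, hn, rfl⟩ := hsupp t ht
    rw [hw n hn]
    simp only [hI, Finset.mem_filter, Finset.mem_range] at hn
    omega

open MvPolynomial in
theorem herm_zeros {F : Type} [Field F] [Fintype F] (q : ℕ) (hq : 2 ≤ q) (Z : Set (F × F))
    (hZ : ∀ P ∈ Z, P.2 ^ q + P.2 = P.1 ^ (q + 1))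
    (f : MvPolynomial (Fin 2) F) (hf : f ≠ 0) (hfy : degreeOf 1 f ≤ q - 1)
    (hfv : ∀ P ∈ Z, eval ![P.1, P.2] f = 0) :
    Z.ncard ≤ weightedTotalDegree ![q, q + 1] f := by
  classical
  let φ : ℕ → ℕ → (Z → F) := fun i j P => P.1.1 ^ i * P.1.2 ^ j
  obtain ⟨l, hl, hlw⟩ := Finset.exists_mem_eq_sup f.support (by simpa using hf)
    (fun s => Finsupp.weight ![q, q + 1] s)
  have hdl : weightedTotalDegree ![q, q + 1] f = l 0 * q + l 1 * (q + 1) := by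
    rw [← herm_weight]; exact hlw
  have hyb : ∀ s ∈ f.support, s 1 < q := by
    intro s hs
    have := (degreeOf_le_iff.1 hfy) s hs
    omega
  have hlt : ∀ s ∈ f.support, s ≠ l → s 0 * q + s 1 * (q + 1) < l 0 * q + l 1 * (q + 1) := by
    intro s hs hsl
    have h1 : s 0 * q + s 1 * (q + 1) ≤ l 0 * q + l 1 * (q + 1) := by
      rw [← hdl, ← herm_weight]
      exact le_weightedTotalDegree _ hs
    refine lt_of_le_of_ne h1 fun h => hsl ?_
    have hmod : s 1 = l 1 := by
      have h2 := congrArg (· % q) h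
      have e : ∀ a b : ℕ, a * q + b * (q + 1) = b + q * (a + b) := by intros; ring
      simp only [e, Nat.add_mul_mod_self_left] at h2
      rwa [Nat.mod_eq_of_lt (hyb s hs), Nat.mod_eq_of_lt (hyb l hl)] at h2
    rw [hmod] at h
    have h0 : s 0 = l 0 := Nat.eq_of_mul_eq_mul_right (by omega) (Nat.add_right_cancel h)
    ext k
    fin_cases k
    · exact h0
    · exact hmod
  generalize ha : l 0 = a at *
  generalize hb : l 1 = b at *
  have hbq : b < q := hb ▸ hyb l hl
  let B : Finset (ℕ × ℕ) := (Finset.range a ×ˢ Finset.Ico b q) ∪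
    (Finset.range (a + q + 1) ×ˢ Finset.range b)
  have hBc : B.card ≤ a * q + b * (q + 1) := by
    refine (Finset.card_union_le _ _).trans ?_
    simp only [Finset.card_product, Finset.card_range, Nat.card_Ico]
    obtain ⟨k, rfl⟩ := Nat.exists_eq_add_of_lt hbq
    have : b + k + 1 - b = k + 1 := by omega
    rw [this]
    apply le_of_eq
    ring
  let W : Submodule F (Z → F) := Submodule.span F ((B.image (fun t => φ t.1 t.2) : Finset (Z → F)) : Set (Z → F))
  have hBW : ∀ i j, (i, j) ∈ B → φ i j ∈ W := by
    intro i j h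
    exact Submodule.subset_span (Finset.mem_coe.2 (Finset.mem_image.2 ⟨(i, j), h, rfl⟩))
  have hcurve : ∀ i j, φ i (j + q) = φ (i + (q + 1)) j - φ i (j + 1) := by
    intro i j
    funext P
    have := hZ P.1 P.2
    simp only [φ, Pi.sub_apply, pow_add, pow_one]
    rw [pow_add, pow_one] at this
    linear_combination P.1.1 ^ i * P.1.2 ^ j * this
  have hmain : ∀ w i j, i * q + j * (q + 1) = w → φ i j ∈ W := by
    intro w
    induction w using Nat.strong_induction_on with
    | _ w ih =>
    have hlead : ∀ i j, i * q + j * (q + 1) = w → a ≤ i → b ≤ j → φ i j ∈ W := by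
      intro i j hw hai hbj
      obtain ⟨i', rfl⟩ := Nat.exists_eq_add_of_le hai
      obtain ⟨j', rfl⟩ := Nat.exists_eq_add_of_le hbj
      have hsum : ∑ s ∈ f.support, coeff s f • φ (s 0 + i') (s 1 + j') = 0 := by
        funext P
        have := hfv P.1 P.2
        rw [eval_eq'] at this
        simp only [Fin.prod_univ_two, Matrix.cons_val_zero, Matrix.cons_val_one] at this
        simp only [Finset.sum_apply, Pi.smul_apply, smul_eq_mul, φ, Pi.zero_apply]
        have h2 := congrArg (· * (P.1.1 ^ i' * P.1.2 ^ j')) this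
        simp only [Finset.sum_mul, zero_mul] at h2
        rw [← h2]
        apply Finset.sum_congr rfl
        intros
        ring
      rw [← Finset.add_sum_erase _ _ hl, ha, hb] at hsum
      have hc : coeff l f ≠ 0 := mem_support_iff.1 hl
      rw [← Submodule.smul_mem_iff W hc, eq_neg_of_add_eq_zero_left hsum]
      apply Submodule.neg_mem
      apply Submodule.sum_mem
      intro s hs
      apply Submodule.smul_mem
      have h3 := hlt s (Finset.mem_of_mem_erase hs) (Finset.ne_of_mem_erase hs)
      refine ih _ ?_ _ _ rfl
      rw [← hw]
      nlinarith
    intro i j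
    induction j using Nat.strong_induction_on generalizing i with
    | _ j ihj =>
    intro hw
    by_cases hjq : q ≤ j
    · obtain ⟨k, rfl⟩ := Nat.exists_eq_add_of_le' hjq
      rw [hcurve]
      apply Submodule.sub_mem
      · apply ihj _ (by omega)
        rw [← hw]; ring
      · refine ih _ ?_ _ _ rfl
        rw [← hw]; nlinarith
    push Not at hjq
    by_cases hbj : b ≤ j
    · by_cases hai : a ≤ i
      · exact hlead i j hw hai hbj
      · apply hBW
        simp [B]
        omega
    · by_cases hai : a + q + 1 ≤ i
      · obtain ⟨k, rfl⟩ : ∃ k, i = k + (q + 1) := ⟨i - (q + 1), by omega⟩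
        have h4 : φ (k + (q + 1)) j = φ k (j + q) + φ k (j + 1) := by
          rw [hcurve]; simp
        rw [h4]
        apply Submodule.add_mem
        · apply hlead
          · rw [← hw]; ring
          · omega
          · omega
        · refine ih _ ?_ _ _ rfl
          rw [← hw]; nlinarith
      · apply hBW
        simp [B]
        omega
  have htop : W = ⊤ := by
    rw [eq_top_iff]
    intro g _
    let G : (Fin 2 → F) → F := fun v => if h : (v 0, v 1) ∈ Z then g ⟨_, h⟩ else 0
    have hG : G ∈ (restrictDegree (Fin 2) F (Fintype.card F - 1)).map (evalₗ F (Fin 2)) := by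
      rw [map_restrict_dom_evalₗ]; trivial
    obtain ⟨P, -, hP⟩ := hG
    have : g = ∑ s ∈ P.support, coeff s P • φ (s 0) (s 1) := by
      funext z
      have h := congrFun hP ![z.1.1, z.1.2]
      rw [evalₗ_apply, eval_eq'] at h
      simp only [Fin.prod_univ_two, Matrix.cons_val_zero, Matrix.cons_val_one] at h
      simp only [Finset.sum_apply, Pi.smul_apply, smul_eq_mul, φ]
      rw [h]
      simp [G]
    rw [this]
    exact Submodule.sum_mem _ fun s _ => Submodule.smul_mem _ _ (hmain _ _ _ rfl)
  have h1 : Module.finrank F W ≤ B.card :=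
    (finrank_span_finset_le_card _).trans Finset.card_image_le
  rw [htop, finrank_top, Module.finrank_fintype_fun_eq_card, ← Nat.card_eq_fintype_card,
    Nat.card_coe_set_eq] at h1
  rw [hdl]
  exact h1.trans hBc

/-- Let `F` be the field with `q²` elements, `q = p^e`, and the Hermitian curve
`β^q + β = α^(q+1)` of genus `g = q(q-1)/2`.  Let `E` and `Ê` be sets of curve points
with `|E| ≤ |Ê|`, and let `Λ` (resp. `Λ̂`) be a nonzero polynomial with `y`-degree at most
`q - 1`, vanishing on `E` (resp. `Ê`), of minimal `(q,q+1)`-weighted degree among all such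
polynomials.  If `deg_{q,q+1} Λ̂ ≤ deg_{q,q+1} Λ`, then `0 ≤ |Ê| - |E| ≤ g`. -/
theorem stmt_11 (p e : ℕ) (hp : p.Prime) (he : 0 < e) (q : ℕ) (hq : q = p ^ e)
    (F : Type) [Field F] [Fintype F] (hF : Fintype.card F = q ^ 2)
    (E Ehat : Set (F × F))
    (hE : ∀ P ∈ E, P.2 ^ q + P.2 = P.1 ^ (q + 1))
    (hEhat : ∀ P ∈ Ehat, P.2 ^ q + P.2 = P.1 ^ (q + 1))
    (hcard : E.ncard ≤ Ehat.ncard)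
    (Λ Λhat : MvPolynomial (Fin 2) F) (hΛ0 : Λ ≠ 0) (hΛhat0 : Λhat ≠ 0)
    (hΛy : MvPolynomial.degreeOf 1 Λ ≤ q - 1)
    (hΛhaty : MvPolynomial.degreeOf 1 Λhat ≤ q - 1)
    (hΛvan : ∀ P ∈ E, MvPolynomial.eval ![P.1, P.2] Λ = 0)
    (hΛhatvan : ∀ P ∈ Ehat, MvPolynomial.eval ![P.1, P.2] Λhat = 0)
    (hΛmin : ∀ μ : MvPolynomial (Fin 2) F, μ ≠ 0 →
      MvPolynomial.degreeOf 1 μ ≤ q - 1 →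
      (∀ P ∈ E, MvPolynomial.eval ![P.1, P.2] μ = 0) →
      MvPolynomial.weightedTotalDegree ![q, q + 1] Λ ≤
        MvPolynomial.weightedTotalDegree ![q, q + 1] μ)
    (hΛhatmin : ∀ μ : MvPolynomial (Fin 2) F, μ ≠ 0 →
      MvPolynomial.degreeOf 1 μ ≤ q - 1 →
      (∀ P ∈ Ehat, MvPolynomial.eval ![P.1, P.2] μ = 0) →
      MvPolynomial.weightedTotalDegree ![q, q + 1] Λhat ≤
        MvPolynomial.weightedTotalDegree ![q, q + 1] μ)
    (hdeg : MvPolynomial.weightedTotalDegree ![q, q + 1] Λhat ≤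
      MvPolynomial.weightedTotalDegree ![q, q + 1] Λ) :
    E.ncard ≤ Ehat.ncard ∧ Ehat.ncard ≤ E.ncard + q * (q - 1) / 2 := by
  have hq2 : 2 ≤ q := by
    rw [hq]
    exact hp.two_le.trans (Nat.le_self_pow he.ne' p)
  refine ⟨hcard, ?_⟩
  obtain ⟨μ, h0, hy, hv, hd⟩ := herm_exists q (by omega) E
  exact (herm_zeros q hq2 Ehat hEhat Λhat hΛhat0 hΛhaty hΛhatvan).trans
    (hdeg.trans ((hΛmin μ h0 hy hv).trans hd))
end

section
/- For every nonzero polynomial p ∈ F[x, y] with deg_y p ≤ q − 1, the formal power series p(X, Y) ∈ F[[X]], obtained by substituting x = X and y = Y, is nonzero and its X-adic order is at most deg_{q,q+1}(p). -/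
/-- The formal power series `Y = Σ_{b=0}^∞ (-1)^b X^{(q+1)q^b}` in `F[[X]]`. -/
noncomputable def Yser (q : ℕ) (F : Type) [Field F] : PowerSeries F :=
  PowerSeries.mk fun n =>
    ∑ b ∈ Finset.range (n + 1), if n = (q + 1) * q ^ b then (-1 : F) ^ b else 0

open PowerSeries in
theorem abstract_bound {F A : Type} [Field F] [CommRing A] [Algebra F A]
    (φ : A →ₐ[F] PowerSeries F) (ψ : A →+* HahnSeries ℤ F)
    (hψC : ∀ c : F, ψ (algebraMap F A c) = HahnSeries.C c)
    (hψ : Function.Injective ψ) (hord : ∀ a : A, (ψ a).order ≤ 0)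
    (f : A) (hf : f ≠ 0) (D : ℕ) (hD : (ψ f).order = -(D : ℤ))
    (x : A) (hx : φ x = X) (q : ℕ) (hxq : (ψ x).order = -(q : ℤ)) :
    ∃ k ≤ D, coeff k (φ f) ≠ 0 := by
  by_contra! hcon
  have hf' : ψ f ≠ 0 := fun h => hf (hψ (by simpa using h))
  let co : ℤ → A →ₗ[F] F := fun k =>
    { toFun := fun a => (ψ a).coeff k
      map_add' := by intro a b; simp
      map_smul' := by
        intro a b
        rw [Algebra.smul_def, map_mul, hψC, HahnSeries.C_mul_eq_smul]
        simp }
  have hco : ∀ k a, co k a = (ψ a).coeff k := fun _ _ => rfl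
  let L : ℕ → Submodule F A := fun n => ⨅ k : {k : ℤ // k < -(n : ℤ)}, LinearMap.ker (co k)
  have hL : ∀ n a, a ∈ L n ↔ ∀ k : ℤ, k < -(n : ℤ) → (ψ a).coeff k = 0 := by
    intro n a
    simp [L, hco]
  have hL' : ∀ n a, a ∈ L n ↔ -(n : ℤ) ≤ (ψ a).order := by
    intro n a
    rw [hL]
    by_cases h0 : ψ a = 0
    · simp [h0]
    · rw [HahnSeries.le_order_iff_forall h0]
  have hfin : ∀ n, FiniteDimensional F (L n) := by
    intro n
    let T : L n →ₗ[F] (Fin (n + 1) → F) :=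
      (LinearMap.pi fun i : Fin (n + 1) => co (-(i : ℤ))) ∘ₗ (L n).subtype
    refine FiniteDimensional.of_injective T ?_
    rw [← LinearMap.ker_eq_bot, LinearMap.ker_eq_bot']
    intro a ha
    by_contra hne
    have hne' : ψ a ≠ 0 := fun h => hne (Subtype.ext (hψ (by simpa using h)))
    have h1 := (hL' n a).1 a.2
    have h2 := hord a
    have h3 := congrFun ha ⟨(-(ψ a).order).toNat, by omega⟩
    simp only [T, LinearMap.comp_apply, LinearMap.pi_apply, Submodule.subtype_apply, hco,
      Pi.zero_apply] at h3
    rw [Int.toNat_of_nonneg (by omega), neg_neg, HahnSeries.coeff_order_eq_zero] at h3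
    exact hne' h3
  set n := q * D with hn
  -- the second filtration step
  have hA : Module.finrank F (L (n + D)) ≤ Module.finrank F (L n) + D := by
    have := hfin (n + D)
    have := hfin n
    let U : L (n + D) →ₗ[F] (Fin D → F) :=
      (LinearMap.pi fun i : Fin D => co (-(n : ℤ) - 1 - i)) ∘ₗ (L (n + D)).subtype
    have h1 := LinearMap.finrank_range_add_finrank_ker U
    have h2 : Module.finrank F (LinearMap.range U) ≤ D := by
      simpa using Submodule.finrank_le (LinearMap.range U)
    have h3 : Module.finrank F (LinearMap.ker U) ≤ Module.finrank F (L n) := by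
      let V : LinearMap.ker U →ₗ[F] L n :=
        LinearMap.codRestrict (L n) ((L (n + D)).subtype ∘ₗ (LinearMap.ker U).subtype) (by
          rintro ⟨⟨a, ha⟩, hU⟩
          rw [hL] at ha ⊢
          intro k hk
          simp only [LinearMap.comp_apply, Submodule.subtype_apply]
          by_cases hk' : k < -((n + D : ℕ) : ℤ)
          · exact ha k hk'
          · have h4 := congrFun (LinearMap.mem_ker.1 hU) ⟨(-(n : ℤ) - 1 - k).toNat, by
              push_cast at hk'; omega⟩
            simp only [U, LinearMap.comp_apply, LinearMap.pi_apply, Submodule.subtype_apply, hco,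
              Pi.zero_apply] at h4
            rw [Int.toNat_of_nonneg (by omega)] at h4
            rw [← h4]; congr 1; ring)
      refine LinearMap.finrank_le_finrank_of_injective (f := V) ?_
      intro a b hab
      have := congrArg Subtype.val hab
      exact Subtype.ext (Subtype.ext this)
    omega
  have hB : Module.finrank F (L n) + (D + 1) ≤ Module.finrank F (L (n + D)) := by
    have := hfin (n + D)
    have := hfin n
    let T : L (n + D) →ₗ[F] (Fin (D + 1) → F) :=
      (LinearMap.pi fun i : Fin (D + 1) => (coeff (R := F) (i : ℕ)) ∘ₗ φ.toLinearMap) ∘ₗ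
        (L (n + D)).subtype
    have hT : ∀ a i, T a i = coeff (i : ℕ) (φ a) := fun _ _ => rfl
    have h1 := LinearMap.finrank_range_add_finrank_ker T
    have hsurj : LinearMap.range T = ⊤ := by
      rw [LinearMap.range_eq_top]
      intro v
      have hmem : ∀ i : Fin (D + 1), x ^ (i : ℕ) ∈ L (n + D) := by
        intro i
        rw [hL', map_pow, HahnSeries.order_pow, hxq]
        have : (i : ℕ) * q ≤ q * D := by
          rw [mul_comm]; exact Nat.mul_le_mul_left _ (by omega)
        have h' : ((i : ℕ) : ℤ) * q ≤ n := by rw [hn]; exact_mod_cast this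
        simp only [nsmul_eq_mul]
        push_cast
        linarith
      refine ⟨∑ i, v i • ⟨x ^ (i : ℕ), hmem i⟩, ?_⟩
      funext j
      rw [hT]
      simp only [AddSubmonoidClass.coe_finsetSum, Submodule.coe_smul, map_sum, map_smul, map_pow,
        hx, coeff_X_pow, smul_eq_mul]
      rw [Finset.sum_eq_single j]
      · simp
      · intro b _ hb
        rw [if_neg (fun h => hb (Fin.ext h.symm)), mul_zero]
      · simp
    have h2 : Module.finrank F (LinearMap.range T) = D + 1 := by
      rw [hsurj]; simp
    have h3 : Module.finrank F (L n) ≤ Module.finrank F (LinearMap.ker T) := by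
      have hm : ∀ a ∈ L n, f * a ∈ L (n + D) := by
        intro a ha
        rw [hL'] at ha ⊢
        by_cases h0 : ψ a = 0
        · rw [map_mul, h0]; simp
        · rw [map_mul, HahnSeries.order_mul hf' h0, hD]; push_cast; omega
      let V1 : L n →ₗ[F] L (n + D) :=
        LinearMap.codRestrict (L (n + D)) ((LinearMap.mulLeft F f) ∘ₗ (L n).subtype)
          (fun a => hm a a.2)
      let V : L n →ₗ[F] LinearMap.ker T := LinearMap.codRestrict (LinearMap.ker T) V1 (by
        intro a
        rw [LinearMap.mem_ker]
        funext i
        rw [hT]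
        change coeff (i : ℕ) (φ (f * a)) = 0
        rw [map_mul, coeff_mul]
        refine Finset.sum_eq_zero fun c hc => ?_
        rw [Finset.HasAntidiagonal.mem_antidiagonal] at hc
        rw [hcon c.1 (by omega), zero_mul])
      refine LinearMap.finrank_le_finrank_of_injective (f := V) ?_
      intro a b hab
      have h5 : f * (a : A) = f * b := congrArg (fun z => (z.1.1 : A)) hab
      have h6 : ψ f * ψ a = ψ f * ψ b := by rw [← map_mul, ← map_mul, h5]
      exact Subtype.ext (hψ (mul_left_cancel₀ hf' h6))
    omega
  omega

theorem coeff_Yser_form (q : ℕ) (hq : 2 ≤ q) (F : Type) [Field F] (b : ℕ) :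
    PowerSeries.coeff ((q + 1) * q ^ b) (Yser q F) = (-1) ^ b := by
  rw [Yser, PowerSeries.coeff_mk, Finset.sum_eq_single b]
  · simp
  · intro c _ hc
    rw [if_neg]
    intro h
    exact hc (Nat.pow_right_injective hq (Nat.eq_of_mul_eq_mul_left (by omega) h)).symm
  · intro h
    exfalso
    apply h
    rw [Finset.mem_range]
    have h1 : b < q ^ b := Nat.lt_pow_self (by omega)
    nlinarith

theorem coeff_Yser_of_not (q : ℕ) (F : Type) [Field F] (n : ℕ)
    (h : ∀ b, n ≠ (q + 1) * q ^ b) : PowerSeries.coeff n (Yser q F) = 0 := by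
  rw [Yser, PowerSeries.coeff_mk]
  exact Finset.sum_eq_zero fun b _ => if_neg (h b)

theorem coeff_pow_q (p e : ℕ) (hp : p.Prime) (F : Type) [Field F] [CharP F p]
    (f : PowerSeries F) (n : ℕ) :
    PowerSeries.coeff n (f ^ p ^ e) =
      if p ^ e ∣ n then (PowerSeries.coeff (n / p ^ e) f) ^ p ^ e else 0 := by
  have : Fact p.Prime := ⟨hp⟩
  have : ExpChar F p := ExpChar.prime hp
  have h := MvPowerSeries.map_iterateFrobenius_expand (σ := Unit) (R := F) p hp.ne_zero f e
  rw [← h]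
  change PowerSeries.coeff n (PowerSeries.map (iterateFrobenius F p e)
    (PowerSeries.expand (p ^ e) (pow_ne_zero e hp.ne_zero) f)) = _
  rw [PowerSeries.coeff_map, PowerSeries.coeff_expand]
  split_ifs
  · rw [iterateFrobenius_def]
  · simp

theorem Yser_rel (p e : ℕ) (hp : p.Prime) (he : 0 < e) (q : ℕ) (hq : q = p ^ e)
    (F : Type) [Field F] [CharP F p] :
    (Yser q F) ^ q + Yser q F = PowerSeries.X ^ (q + 1) := by
  have h2 : 2 ≤ q := by
    rw [hq]; exact hp.two_le.trans (Nat.le_self_pow he.ne' p)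
  have : Fact p.Prime := ⟨hp⟩
  have : ExpChar F p := ExpChar.prime hp
  have hneg : ∀ b : ℕ, ((-1 : F) ^ b) ^ q = (-1) ^ b := by
    intro b
    rw [hq, ← iterateFrobenius_def, map_pow, map_neg, map_one]
  have hpow : ∀ n, PowerSeries.coeff n ((Yser q F) ^ q) =
      if q ∣ n then (PowerSeries.coeff (n / q) (Yser q F)) ^ q else 0 := by
    intro n
    have := coeff_pow_q p e hp F (Yser q F) n
    rwa [← hq] at this
  ext n
  rw [map_add, hpow, PowerSeries.coeff_X_pow]
  by_cases hn : ∃ b, n = (q + 1) * q ^ b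
  · obtain ⟨b, rfl⟩ := hn
    rw [coeff_Yser_form q h2]
    cases b with
    | zero =>
      have : ¬ q ∣ (q + 1) * q ^ 0 := by
        rw [pow_zero, mul_one, Nat.dvd_add_right (dvd_refl q), Nat.dvd_one]
        omega
      rw [if_neg this]
      simp
    | succ b =>
      have e1 : (q + 1) * q ^ (b + 1) = q * ((q + 1) * q ^ b) := by ring
      rw [if_pos ⟨_, e1⟩, if_neg, e1, Nat.mul_div_cancel_left _ (by omega),
        coeff_Yser_form q h2, hneg]
      · ring
      · intro h
        clear e1
        have : q + 1 < (q + 1) * q ^ (b + 1) := by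
          have := Nat.one_lt_pow (Nat.succ_ne_zero b) (show 1 < q by omega)
          exact lt_mul_of_one_lt_right (by omega) this
        omega
  · push Not at hn
    have hn0 : n ≠ q + 1 := by simpa using hn 0
    rw [coeff_Yser_of_not q F n hn, if_neg hn0]
    split_ifs with hd
    · obtain ⟨m, rfl⟩ := hd
      rw [Nat.mul_div_cancel_left _ (by omega), coeff_Yser_of_not]
      · simp; omega
      · intro b hb
        exact hn (b + 1) (by rw [hb]; ring)
    · simp

/-- order of `Y` as a Laurent series. -/
theorem order_Yser (q : ℕ) (hq : 2 ≤ q) (F : Type) [Field F] :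
    HahnSeries.ofPowerSeries ℤ F (Yser q F) ≠ 0 ∧
    (HahnSeries.ofPowerSeries ℤ F (Yser q F)).order = (q : ℤ) + 1 := by
  have h1 : (HahnSeries.ofPowerSeries ℤ F (Yser q F)).coeff ((q + 1 : ℕ) : ℤ) ≠ 0 := by
    have := HahnSeries.ofPowerSeries_apply_coeff (Γ := ℤ) (Yser q F) (q + 1)
    have h2 := coeff_Yser_form q hq F 0
    simp only [pow_zero, mul_one] at h2
    rw [h2] at this
    intro h
    rw [h] at this
    exact zero_ne_one this
  have h0 : HahnSeries.ofPowerSeries ℤ F (Yser q F) ≠ 0 := by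
    intro h; rw [h] at h1; exact h1 rfl
  refine ⟨h0, le_antisymm ?_ ?_⟩
  · exact_mod_cast HahnSeries.order_le_of_coeff_ne_zero h1
  · rw [HahnSeries.le_order_iff_forall h0]
    intro j hj
    by_cases hj0 : j < 0
    · rw [HahnSeries.ofPowerSeries_apply]
      apply HahnSeries.embDomain_of_notMem_range
      rintro ⟨k, rfl⟩
      simp at hj0
      omega
    · obtain ⟨k, rfl⟩ := Int.eq_ofNat_of_zero_le (not_lt.1 hj0)
      have := HahnSeries.ofPowerSeries_apply_coeff (Γ := ℤ) (Yser q F) k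
      refine this.trans (coeff_Yser_of_not q F k ?_)
      intro b hb
      have : 1 ≤ q ^ b := Nat.one_le_pow _ _ (by omega)
      have : q + 1 ≤ k := by rw [hb]; nlinarith
      omega

open MvPolynomial in
theorem reduce_exists (q : ℕ) (hq : 2 ≤ q) (F : Type) [Field F] (g : MvPolynomial (Fin 2) F) :
    ∃ r : MvPolynomial (Fin 2) F, degreeOf 1 r ≤ q - 1 ∧
      g - r ∈ Ideal.span {(X 1 ^ q + X 1 - X 0 ^ (q + 1) : MvPolynomial (Fin 2) F)} := by
  set I := Ideal.span {(X 1 ^ q + X 1 - X 0 ^ (q + 1) : MvPolynomial (Fin 2) F)} with hI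
  have hadd : ∀ g h : MvPolynomial (Fin 2) F, (∃ r, degreeOf 1 r ≤ q - 1 ∧ g - r ∈ I) →
      (∃ r, degreeOf 1 r ≤ q - 1 ∧ h - r ∈ I) → ∃ r, degreeOf 1 r ≤ q - 1 ∧ (g + h) - r ∈ I := by
    rintro g h ⟨r, hr, hgr⟩ ⟨s, hs, hhs⟩
    refine ⟨r + s, (degreeOf_add_le _ _ _).trans (max_le hr hs), ?_⟩
    have : g + h - (r + s) = (g - r) + (h - s) := by ring
    rw [this]; exact I.add_mem hgr hhs
  have hmon : ∀ j i : ℕ, ∀ c : F, ∃ r, degreeOf 1 r ≤ q - 1 ∧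
      (C c * X 0 ^ i * X 1 ^ j : MvPolynomial (Fin 2) F) - r ∈ I := by
    intro j
    induction j using Nat.strong_induction_on with
    | _ j ih =>
      intro i c
      by_cases hj : j < q
      · refine ⟨C c * X 0 ^ i * X 1 ^ j, ?_, by simp⟩
        refine (degreeOf_mul_le _ _ _).trans ?_
        have h1 : degreeOf 1 (C c * X 0 ^ i : MvPolynomial (Fin 2) F) = 0 := by
          refine Nat.le_zero.1 ((degreeOf_mul_le _ _ _).trans ?_)
          rw [degreeOf_C, degreeOf_X_pow_of_ne i (by decide)]
        rw [h1, degreeOf_X_self_pow]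
        omega
      · obtain ⟨k, rfl⟩ := Nat.exists_eq_add_of_le (not_lt.1 hj)
        obtain ⟨r, hr, hr'⟩ := hadd _ _ (ih k (by omega) (i + (q + 1)) c)
          (ih (k + 1) (by omega) i (-c))
        refine ⟨r, hr, ?_⟩
        have : (C c * X 0 ^ i * X 1 ^ (q + k) : MvPolynomial (Fin 2) F) - r =
            (C c * X 0 ^ (i + (q + 1)) * X 1 ^ k + C (-c) * X 0 ^ i * X 1 ^ (k + 1) - r) +
            (C c * X 0 ^ i * X 1 ^ k) * (X 1 ^ q + X 1 - X 0 ^ (q + 1)) := by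
          rw [C_neg]; ring
        rw [this]
        exact I.add_mem hr' (I.mul_mem_left _ (Ideal.subset_span rfl))
  induction g using MvPolynomial.induction_on' with
  | monomial u a =>
    have := hmon (u 1) (u 0) a
    rwa [show (C a * X 0 ^ u 0 * X 1 ^ u 1 : MvPolynomial (Fin 2) F) = monomial u a by
      rw [monomial_eq, Finsupp.prod_fintype _ _ (by simp), Fin.prod_univ_two, mul_assoc]] at this
  | add p r hp hr => exact hadd _ _ hp hr

theorem weight_two (q : ℕ) (m : Fin 2 →₀ ℕ) :
    Finsupp.weight ![q, q + 1] m = m 0 * q + m 1 * (q + 1) := by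
  rw [Finsupp.weight_apply, Finsupp.sum_fintype _ _ (by simp), Fin.sum_univ_two]
  simp

theorem wdeg_cast (q : ℕ) (F : Type) [Field F] (f : MvPolynomial (Fin 2) F) (hf : f ≠ 0) :
    ((MvPolynomial.weightedTotalDegree ![q, q + 1] f : ℕ) : ℕ∞) ≤
      (MvPolynomial.weightedTotalDegree ![(q : ℕ∞), (q : ℕ∞) + 1] f : ℕ∞) := by
  obtain ⟨m, hm, hmD⟩ := Finset.exists_mem_eq_sup f.support
    (MvPolynomial.support_nonempty.2 hf) (fun s => Finsupp.weight ![q, q + 1] s)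
  change MvPolynomial.weightedTotalDegree ![q, q + 1] f = _ at hmD
  refine le_trans (le_of_eq ?_)
    (MvPolynomial.le_weightedTotalDegree ![(q : ℕ∞), (q : ℕ∞) + 1] hm)
  rw [hmD, weight_two, Finsupp.weight_apply, Finsupp.sum_fintype _ _ (by simp), Fin.sum_univ_two]
  simp [mul_add]

/-- The expansion at the point at infinity. -/
noncomputable def psiInf (q : ℕ) (F : Type) [Field F] :
    MvPolynomial (Fin 2) F →+* HahnSeries ℤ F :=
  MvPolynomial.eval₂Hom HahnSeries.C
    ![HahnSeries.single 1 1 * (HahnSeries.ofPowerSeries ℤ F (Yser q F))⁻¹,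
      (HahnSeries.ofPowerSeries ℤ F (Yser q F))⁻¹]

theorem order_inv_aux {F : Type} [Field F] (y : HahnSeries ℤ F) (hy : y ≠ 0) :
    (y⁻¹).order = -y.order := by
  have h := HahnSeries.order_mul hy (inv_ne_zero hy)
  rw [mul_inv_cancel₀ hy, HahnSeries.order_one] at h
  omega

theorem order_psiInf (q : ℕ) (hq : 2 ≤ q) (F : Type) [Field F]
    (r : MvPolynomial (Fin 2) F) (hr : r ≠ 0) (hd : MvPolynomial.degreeOf 1 r ≤ q - 1) :
    psiInf q F r ≠ 0 ∧
    (psiInf q F r).order = -((MvPolynomial.weightedTotalDegree ![q, q + 1] r : ℕ) : ℤ) := by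
  obtain ⟨hY0, hYo⟩ := order_Yser q hq F
  set y := (HahnSeries.ofPowerSeries ℤ F (Yser q F))⁻¹ with hy
  have hy0 : y ≠ 0 := inv_ne_zero hY0
  have hyo : y.order = -((q : ℤ) + 1) := by rw [hy, order_inv_aux _ hY0, hYo]
  set x : HahnSeries ℤ F := HahnSeries.single 1 1 * y with hx
  have hs0 : (HahnSeries.single 1 1 : HahnSeries ℤ F) ≠ 0 := by simp
  have hx0 : x ≠ 0 := mul_ne_zero hs0 hy0
  have hxo : x.order = -(q : ℤ) := by
    rw [hx, HahnSeries.order_mul hs0 hy0, HahnSeries.order_single one_ne_zero, hyo]; ring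
  have hm0 : ∀ m : Fin 2 →₀ ℕ, x ^ m 0 * y ^ m 1 ≠ 0 := fun m =>
    mul_ne_zero (pow_ne_zero _ hx0) (pow_ne_zero _ hy0)
  have hmo : ∀ m : Fin 2 →₀ ℕ, (x ^ m 0 * y ^ m 1).order =
      -((Finsupp.weight ![q, q + 1] m : ℕ) : ℤ) := by
    intro m
    rw [HahnSeries.order_mul (pow_ne_zero _ hx0) (pow_ne_zero _ hy0), HahnSeries.order_pow,
      HahnSeries.order_pow, hxo, hyo, weight_two]
    simp only [nsmul_eq_mul]
    push_cast
    ring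
  have hcoef : ∀ k : ℤ, (psiInf q F r).coeff k =
      ∑ m ∈ r.support, r.coeff m * (x ^ m 0 * y ^ m 1).coeff k := by
    intro k
    have h1 : psiInf q F r = ∑ m ∈ r.support, r.coeff m • (x ^ m 0 * y ^ m 1) := by
      rw [psiInf, MvPolynomial.coe_eval₂Hom, MvPolynomial.eval₂_eq']
      refine Finset.sum_congr rfl fun m _ => ?_
      rw [Fin.prod_univ_two, HahnSeries.C_mul_eq_smul]
      rfl
    rw [h1, HahnSeries.coeff_sum]
    simp
  obtain ⟨m, hm, hmD⟩ := Finset.exists_mem_eq_sup r.support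
    (MvPolynomial.support_nonempty.2 hr) (fun s => Finsupp.weight ![q, q + 1] s)
  change MvPolynomial.weightedTotalDegree ![q, q + 1] r = _ at hmD
  have hlt : ∀ m' ∈ r.support, m' 1 < q := by
    intro m' hm'
    have := (MvPolynomial.le_degreeOf_of_mem_support 1 hm').trans hd
    omega
  have hinj : ∀ m' ∈ r.support, Finsupp.weight ![q, q + 1] m' = Finsupp.weight ![q, q + 1] m →
      m' = m := by
    intro m' hm' h
    rw [weight_two, weight_two] at h
    have h1 := hlt m' hm'
    have h2 := hlt m hm
    have e1 : m' 0 * q + m' 1 * (q + 1) = m' 1 + q * (m' 0 + m' 1) := by ring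
    have e2 : m 0 * q + m 1 * (q + 1) = m 1 + q * (m 0 + m 1) := by ring
    rw [e1, e2] at h
    have h3 := congrArg (· % q) h
    simp only [Nat.add_mul_mod_self_left, Nat.mod_eq_of_lt h1, Nat.mod_eq_of_lt h2] at h3
    rw [h3] at h
    have h4 := Nat.eq_of_mul_eq_mul_left (by omega : 0 < q) (Nat.add_left_cancel h)
    ext i
    fin_cases i
    · simp only [Fin.zero_eta]; omega
    · exact h3
  have htop : (psiInf q F r).coeff
      (-((MvPolynomial.weightedTotalDegree ![q, q + 1] r : ℕ) : ℤ)) ≠ 0 := by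
    rw [hcoef, Finset.sum_eq_single_of_mem m hm]
    · refine mul_ne_zero (MvPolynomial.mem_support_iff.1 hm) ?_
      rw [hmD, ← hmo, Ne, HahnSeries.coeff_order_eq_zero]
      exact hm0 m
    · intro m' hm' hne
      rw [HahnSeries.coeff_eq_zero_of_lt_order, mul_zero]
      rw [hmo]
      have h1 := MvPolynomial.le_weightedTotalDegree ![q, q + 1] hm'
      have h2 : Finsupp.weight ![q, q + 1] m' ≠ MvPolynomial.weightedTotalDegree ![q, q + 1] r :=
        fun h => hne (hinj m' hm' (h.trans hmD))
      omega
  have hne : psiInf q F r ≠ 0 := by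
    intro h; rw [h] at htop; exact htop rfl
  refine ⟨hne, le_antisymm (HahnSeries.order_le_of_coeff_ne_zero htop) ?_⟩
  rw [HahnSeries.le_order_iff_forall hne]
  intro k hk
  rw [hcoef]
  refine Finset.sum_eq_zero fun m' hm' => ?_
  rw [HahnSeries.coeff_eq_zero_of_lt_order, mul_zero]
  rw [hmo]
  have h1 := MvPolynomial.le_weightedTotalDegree ![q, q + 1] hm'
  omega

/-- Let `F` be the field with `q²` elements, `q = p^e`.  For every nonzero polynomial
`f ∈ F[x,y]` with `deg_y f ≤ q - 1`, the power series `f(X, Y) ∈ F[[X]]` obtained by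
substituting `x = X` and `y = Y = Σ_b (-1)^b X^{(q+1)q^b}` is nonzero and its `X`-adic
order is at most the weighted degree `deg_{q,q+1} f`. -/
theorem stmt_12 (p e : ℕ) (hp : p.Prime) (he : 0 < e) (q : ℕ) (hq : q = p ^ e)
    (F : Type) [Field F] [Fintype F] (hF : Fintype.card F = q ^ 2)
    (f : MvPolynomial (Fin 2) F) (hf : f ≠ 0)
    (hfy : MvPolynomial.degreeOf 1 f ≤ q - 1) :
    MvPolynomial.aeval ![PowerSeries.X, Yser q F] f ≠ 0 ∧
      (MvPolynomial.aeval ![PowerSeries.X, Yser q F] f).order ≤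
        (MvPolynomial.weightedTotalDegree ![q, q + 1] f : ℕ∞) := by


  have h2 : 2 ≤ q := by
    rw [hq]; exact hp.two_le.trans (Nat.le_self_pow he.ne' p)
  have hchar : CharP F p := by
    have : Fact p.Prime := ⟨hp⟩
    refine charP_of_card_eq_prime_pow (f := e * 2) ?_
    rw [hF, hq, pow_mul]
  have hrel := Yser_rel p e hp he q hq F
  obtain ⟨hY0, hYo⟩ := order_Yser q h2 F
  set φ0 : MvPolynomial (Fin 2) F →ₐ[F] PowerSeries F :=
    MvPolynomial.aeval ![PowerSeries.X, Yser q F] with hφ0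
  set ψ0 := psiInf q F with hψ0
  have hφX : φ0 (MvPolynomial.X 0) = PowerSeries.X := by simp [hφ0]
  have hφY : φ0 (MvPolynomial.X 1) = Yser q F := by simp [hφ0]
  have hψX : ψ0 (MvPolynomial.X 0) =
      HahnSeries.single 1 1 * (HahnSeries.ofPowerSeries ℤ F (Yser q F))⁻¹ := by
    simp [hψ0, psiInf]
  have hψY : ψ0 (MvPolynomial.X 1) = (HahnSeries.ofPowerSeries ℤ F (Yser q F))⁻¹ := by
    simp [hψ0, psiInf]
  have hφr : φ0 (MvPolynomial.X 1 ^ q + MvPolynomial.X 1 - MvPolynomial.X 0 ^ (q + 1)) = 0 := by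
    rw [map_sub, map_add, map_pow, map_pow, hφX, hφY, hrel, sub_self]
  have hψr : ψ0 (MvPolynomial.X 1 ^ q + MvPolynomial.X 1 - MvPolynomial.X 0 ^ (q + 1)) = 0 := by
    rw [map_sub, map_add, map_pow, map_pow, hψX, hψY]
    have hr2 := congrArg (HahnSeries.ofPowerSeries ℤ F) hrel
    rw [map_add, map_pow, map_pow, HahnSeries.ofPowerSeries_X] at hr2
    rw [mul_pow, ← hr2]
    generalize HahnSeries.ofPowerSeries ℤ F (Yser q F) = y at hY0
    have : y * y⁻¹ = 1 := mul_inv_cancel₀ hY0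
    have h3 : y ^ q * y⁻¹ ^ q = 1 := by rw [← mul_pow, this, one_pow]
    have h4 : (y ^ q + y) * y⁻¹ ^ (q + 1) =
      (y ^ q * y⁻¹ ^ q) * y⁻¹ + (y * y⁻¹) * y⁻¹ ^ q := by ring
    rw [h4, this, h3]
    ring
  have hred : ∀ g : MvPolynomial (Fin 2) F, ∃ r : MvPolynomial (Fin 2) F,
      MvPolynomial.degreeOf 1 r ≤ q - 1 ∧ φ0 g = φ0 r ∧ ψ0 g = ψ0 r := by
    intro g
    obtain ⟨r, hr, hmem⟩ := reduce_exists q h2 F g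
    obtain ⟨s, hs⟩ := Ideal.mem_span_singleton'.1 hmem
    refine ⟨r, hr, ?_, ?_⟩
    · rw [← sub_eq_zero, ← map_sub, ← hs, map_mul, hφr, mul_zero]
    · rw [← sub_eq_zero, ← map_sub, ← hs, map_mul, hψr, mul_zero]
  have hker : ∀ g : MvPolynomial (Fin 2) F, g ∈ RingHom.ker ψ0 → φ0 g = 0 := by
    intro g hg
    obtain ⟨r, hr, h3, h4⟩ := hred g
    rw [RingHom.mem_ker, h4] at hg
    by_cases hr0 : r = 0
    · rw [h3, hr0, map_zero]
    · exact absurd hg (order_psiInf q h2 F r hr0 hr).1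
  obtain ⟨hf1, hf2⟩ := order_psiInf q h2 F f hf hfy
  obtain ⟨k, hk, hk'⟩ := abstract_bound (A := MvPolynomial (Fin 2) F ⧸ RingHom.ker ψ0)
    (Ideal.Quotient.liftₐ (RingHom.ker ψ0) φ0 hker) (RingHom.kerLift ψ0)
    (by
      intro c
      change ψ0 (MvPolynomial.C c) = _
      simp [hψ0, psiInf])
    (RingHom.kerLift_injective ψ0)
    (by
      intro a
      obtain ⟨g, rfl⟩ := Ideal.Quotient.mk_surjective a
      change (ψ0 g).order ≤ 0
      obtain ⟨r, hr, -, h4⟩ := hred g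
      rw [h4]
      by_cases hr0 : r = 0
      · rw [hr0, map_zero, HahnSeries.order_zero]
      · rw [(order_psiInf q h2 F r hr0 hr).2]; omega)
    (Ideal.Quotient.mk _ f)
    (by
      rw [Ne, Ideal.Quotient.eq_zero_iff_mem, RingHom.mem_ker]
      exact hf1)
    (MvPolynomial.weightedTotalDegree ![q, q + 1] f) hf2
    (Ideal.Quotient.mk _ (MvPolynomial.X 0)) hφX q
    (by
      change (ψ0 (MvPolynomial.X 0)).order = _
      rw [hψX, HahnSeries.order_mul (by simp) (inv_ne_zero hY0),
        HahnSeries.order_single one_ne_zero, order_inv_aux _ hY0, hYo]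
      ring)
  change PowerSeries.coeff k (φ0 f) ≠ 0 at hk'
  refine ⟨?_, ?_⟩
  · intro h; rw [h] at hk'; simp at hk'
  · exact (PowerSeries.order_le k hk').trans (le_trans (Nat.cast_le.2 hk) (wdeg_cast q F f hf))
end

section
/- Let m and k be nonnegative integers, let Q_0, …, Q_ℓ ∈ F[x, y] be polynomials with deg_y Q_t ≤ q − 1 for all t, not all zero, and let h ∈ F[x, y] satisfy deg_y h ≤ q − 1 and deg_{q,q+1}(h) ≤ m. If k > max_t ( deg_{q,q+1}(Q_t) + t·m ) and X^k divides the power series Σ_{t=0}^ℓ Q_t(X, Y) · h(X, Y)^t in F[[X]], then the polynomial Σ_{t=0}^ℓ Q_t · h^t lies in the ideal of F[x, y] generated by y^q + y − x^{q+1}. -/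
open MvPolynomial

open scoped Polynomial

/-- Weighted degree bound in `F[x][y]`, with a shift `s` in the `y` exponent. -/
def WleH (q s : ℕ) {F : Type} [Field F] (P : F[X][X]) (n : ℕ) : Prop :=
  ∀ i j, (P.coeff j).coeff i ≠ 0 → q * i + (q + 1) * (j + s) ≤ n

section
variable {F : Type} [Field F] {q : ℕ}

lemma WleH.mono {P : F[X][X]} {n m : ℕ} (h : WleH q 0 P n) (hnm : n ≤ m) : WleH q 0 P m :=
  fun i j hij => (h i j hij).trans hnm

lemma WleH.zero {n : ℕ} : WleH q 0 (0 : F[X][X]) n := fun i j hij => by simp at hij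

lemma WleH.add {P R : F[X][X]} {n : ℕ} (h : WleH q 0 P n) (h2 : WleH q 0 R n) :
    WleH q 0 (P + R) n := by
  intro i j hij
  by_cases h0 : (P.coeff j).coeff i = 0
  · apply h2
    intro h1
    apply hij
    simp [h0, h1]
  · exact h i j h0

lemma WleH.sum {ι : Type*} (s : Finset ι) (P : ι → F[X][X]) {n : ℕ}
    (h : ∀ i ∈ s, WleH q 0 (P i) n) : WleH q 0 (∑ i ∈ s, P i) n := by
  classical
  induction s using Finset.induction_on with
  | empty => simpa using WleH.zero
  | insert a s ha ih =>
    rw [Finset.sum_insert ha]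
    exact (h a (by simp)).add (ih fun i hi => h i (by simp [hi]))

lemma WleH.mul {P R : F[X][X]} {n m : ℕ} (h : WleH q 0 P n) (h2 : WleH q 0 R m) :
    WleH q 0 (P * R) (n + m) := by
  intro i j hij
  rw [Polynomial.coeff_mul, Polynomial.finsetSum_coeff] at hij
  obtain ⟨⟨a, b⟩, hab, hne⟩ := Finset.exists_ne_zero_of_sum_ne_zero hij
  rw [Polynomial.coeff_mul] at hne
  obtain ⟨⟨c, d⟩, hcd, hne⟩ := Finset.exists_ne_zero_of_sum_ne_zero hne
  rw [Finset.HasAntidiagonal.mem_antidiagonal] at hab hcd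
  dsimp only at hab hcd
  have h3 := h c a (left_ne_zero_of_mul hne)
  have h4 := h2 d b (right_ne_zero_of_mul hne)
  subst hab hcd
  nlinarith

lemma WleH.CC (c : F) (n : ℕ) : WleH q 0 (Polynomial.C (Polynomial.C c)) n := by
  intro i j hij
  rw [Polynomial.coeff_C] at hij
  split_ifs at hij with h
  · rw [Polynomial.coeff_C] at hij
    split_ifs at hij with h2
    · simp [h, h2]
    · simp at hij
  · simp at hij

lemma WleH.CX : WleH q 0 (Polynomial.C (Polynomial.X) : F[X][X]) q := by
  intro i j hij
  rw [Polynomial.coeff_C] at hij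
  split_ifs at hij with h
  · rw [Polynomial.coeff_X] at hij
    split_ifs at hij with h2
    · simp [h, ← h2]
    · simp at hij
  · simp at hij

lemma WleH.X : WleH q 0 (Polynomial.X : F[X][X]) (q + 1) := by
  intro i j hij
  rw [Polynomial.coeff_X] at hij
  split_ifs at hij with h
  · rw [Polynomial.coeff_one] at hij
    split_ifs at hij with h2
    · simp [← h, h2]
    · simp at hij
  · simp at hij

lemma WleH.pow {P : F[X][X]} {n : ℕ} (h : WleH q 0 P n) (k : ℕ) :
    WleH q 0 (P ^ k) (k * n) := by
  induction k with
  | zero => simpa using WleH.CC (q := q) (1 : F) 0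
  | succ k ih =>
    rw [pow_succ, Nat.succ_mul]
    exact ih.mul h

lemma WleH.prod {ι : Type*} (s : Finset ι) (P : ι → F[X][X]) {n : ℕ}
    (h : ∀ i ∈ s, WleH q 0 (P i) n) : WleH q 0 (∏ i ∈ s, P i) (s.card * n) := by
  classical
  induction s using Finset.induction_on with
  | empty => simpa using WleH.CC (q := q) (1 : F) 0
  | insert a s ha ih =>
    rw [Finset.prod_insert ha, Finset.card_insert_of_notMem ha, add_mul, one_mul, add_comm]
    exact (h a (by simp)).mul (ih fun i hi => h i (by simp [hi]))

lemma WleH.comp {P : F[X][X]} {n : ℕ} (h : WleH q 0 P n) (c : F) :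
    WleH q 0 (P.comp (Polynomial.X + Polynomial.C (Polynomial.C c))) n := by
  rw [Polynomial.comp, Polynomial.eval₂_eq_sum, Polynomial.sum]
  refine WleH.sum _ _ fun j hj => ?_
  rw [(P.coeff j).as_sum_support_C_mul_X_pow, map_sum, Finset.sum_mul]
  refine WleH.sum _ _ fun i hi => ?_
  have h1 := h i j (by simpa using hi)
  rw [map_mul, map_pow]
  refine WleH.mono (((WleH.CC _ 0).mul (WleH.CX.pow i)).mul
    ((WleH.X.add (WleH.CC c _)).pow j)) ?_
  nlinarith

/-- The map `F[x,y] → F[x][y]`. -/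
noncomputable def phiH (F : Type) [Field F] : MvPolynomial (Fin 2) F →ₐ[F] F[X][X] :=
  MvPolynomial.aeval ![Polynomial.C Polynomial.X, Polynomial.X]

/-- The map `F[x][y] → F[x,y]`. -/
noncomputable def chiH (F : Type) [Field F] : F[X][X] →+* MvPolynomial (Fin 2) F :=
  Polynomial.eval₂RingHom
    (Polynomial.aeval (X 0 : MvPolynomial (Fin 2) F) : F[X] →ₐ[F] _).toRingHom (X 1)

lemma chiH_phiH (P : MvPolynomial (Fin 2) F) : chiH F (phiH F P) = P := by
  induction P using MvPolynomial.induction_on with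
  | C a => simp [chiH, phiH, Polynomial.algebraMap_apply]
  | add p q hp hq => rw [map_add, map_add, hp, hq]
  | mul_X p n hp =>
    rw [map_mul, map_mul, hp]
    fin_cases n <;> simp [chiH, phiH]

lemma phiH_wle (P : MvPolynomial (Fin 2) F) :
    WleH q 0 (phiH F P) (MvPolynomial.weightedTotalDegree ![q, q + 1] P) := by
  conv => arg 3; rw [P.as_sum]
  rw [map_sum]
  refine WleH.sum _ _ fun d hd => ?_
  have h1 := MvPolynomial.le_weightedTotalDegree ![q, q + 1] hd
  rw [phiH, MvPolynomial.aeval_monomial, Finsupp.prod_fintype _ _ (by simp)]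
  simp only [Fin.prod_univ_two]
  refine WleH.mono ((WleH.CC _ 0).mul ((WleH.CX.pow (d 0)).mul (WleH.X.pow (d 1)))) ?_
  rw [Finsupp.weight_apply, Finsupp.sum_fintype _ _ (by simp)] at h1
  simpa [Fin.sum_univ_two] using h1

/-- Evaluation at `(X, Y)`. -/
noncomputable def psiH (q : ℕ) (F : Type) [Field F] : F[X][X] →+* PowerSeries F :=
  Polynomial.eval₂RingHom (Polynomial.coeToPowerSeries.ringHom) (Yser q F)

lemma psiH_phiH (P : MvPolynomial (Fin 2) F) :
    psiH q F (phiH F P) = MvPolynomial.aeval ![PowerSeries.X, Yser q F] P := by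
  induction P using MvPolynomial.induction_on with
  | C a => simp [psiH, phiH, Polynomial.algebraMap_apply]
  | add p q hp hq => simp only [map_add, hp, hq]
  | mul_X p n hp =>
    rw [map_mul, map_mul, hp, map_mul]
    fin_cases n <;> simp [psiH, phiH]

/-- `y^q + y`. -/
noncomputable def gH (q : ℕ) (F : Type) [Field F] : F[X][X] := Polynomial.X ^ q + Polynomial.X

/-- `y^q + y - x^(q+1)`. -/
noncomputable def fH (q : ℕ) (F : Type) [Field F] : F[X][X] :=
  gH q F - Polynomial.C (Polynomial.X ^ (q + 1))

lemma Yser_decomp (hq : 2 ≤ q) (B : ℕ) : (PowerSeries.X : PowerSeries F) ^ B ∣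
    Yser q F - ∑ b ∈ Finset.range B, (-1) ^ b * PowerSeries.X ^ ((q + 1) * q ^ b) := by
  rw [PowerSeries.X_pow_dvd_iff]
  intro n hn
  have hc : ∀ b, ((-1) ^ b * PowerSeries.X ^ ((q + 1) * q ^ b) : PowerSeries F) =
      PowerSeries.C ((-1) ^ b) * PowerSeries.X ^ ((q + 1) * q ^ b) := by
    intro b; simp
  simp only [hc]
  rw [map_sub, map_sum, Yser, PowerSeries.coeff_mk, sub_eq_zero]
  simp only [PowerSeries.coeff_C_mul, PowerSeries.coeff_X_pow, mul_ite, mul_one, mul_zero]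
  refine Finset.sum_subset (fun b hb => ?_) (fun b _ hb => ?_)
  · simp at hb ⊢; omega
  · simp only [Finset.mem_range, not_lt] at hb
    rw [if_neg]
    intro h
    have := Nat.lt_pow_self (n := b) (a := q) (by omega)
    nlinarith

lemma Yser_eq (p e : ℕ) [Fact p.Prime] [CharP F p] (hq : q = p ^ e) (hq2 : 2 ≤ q) :
    (Yser q F) ^ q + Yser q F = PowerSeries.X ^ (q + 1) := by
  haveI : CharP (PowerSeries F) p := charP_of_injective_ringHom PowerSeries.C_injective p
  have hneg : (-1 : PowerSeries F) ^ q = -1 := by rw [hq]; exact neg_one_pow_char_pow _ _ _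
  have hadd : ∀ a b : PowerSeries F, (a + b) ^ q = a ^ q + b ^ q := by
    intro a b; rw [hq]; exact add_pow_char_pow _ _ _ _
  have key : ∀ B, (∑ b ∈ Finset.range B,
        ((-1) ^ b * PowerSeries.X ^ ((q + 1) * q ^ b) : PowerSeries F)) ^ q +
      ∑ b ∈ Finset.range B, ((-1) ^ b * PowerSeries.X ^ ((q + 1) * q ^ b) : PowerSeries F)
      = PowerSeries.X ^ (q + 1) - (-1) ^ B * PowerSeries.X ^ ((q + 1) * q ^ B) := by
    intro B
    induction B with
    | zero => simp; omega
    | succ B ih =>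
      rw [Finset.sum_range_succ, hadd, mul_pow, ← pow_mul, mul_comm B q, pow_mul, hneg,
        ← pow_mul, mul_assoc (q + 1), ← pow_succ]
      linear_combination ih
  rw [← sub_eq_zero]
  ext n
  obtain ⟨U, hU⟩ := Yser_decomp (F := F) hq2 (n + 1)
  have hd : (PowerSeries.X : PowerSeries F) ^ (n + 1) ∣
      (Yser q F) ^ q + Yser q F - PowerSeries.X ^ (q + 1) := by
    rw [sub_eq_iff_eq_add] at hU
    rw [hU, hadd, mul_pow]
    have h1 : (PowerSeries.X : PowerSeries F) ^ (n + 1) ∣ PowerSeries.X ^ ((q + 1) * q ^ (n + 1)) := by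
      apply pow_dvd_pow
      have := Nat.lt_pow_self (n := n + 1) (a := q) (by omega)
      nlinarith
    have h2 : (PowerSeries.X : PowerSeries F) ^ (n + 1) ∣ (PowerSeries.X ^ (n + 1)) ^ q :=
      dvd_pow_self _ (by omega)
    obtain ⟨a, ha⟩ := h1
    obtain ⟨b, hb⟩ := h2
    refine ⟨b * U ^ q + U - (-1) ^ (n + 1) * a, ?_⟩
    linear_combination key (n + 1) + U ^ q * hb - (-1) ^ (n + 1) * ha
  rw [PowerSeries.X_pow_dvd_iff] at hd
  simpa using hd n (by omega)

lemma psiH_fH (p e : ℕ) [Fact p.Prime] [CharP F p] (hq : q = p ^ e) (hq2 : 2 ≤ q) :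
    psiH q F (fH q F) = 0 := by
  have := Yser_eq (F := F) p e hq hq2
  rw [fH, gH, map_pow]
  simp [psiH, -map_pow, Polynomial.eval₂_pow, this]

lemma gH_comp (p e : ℕ) [Fact p.Prime] [CharP F p] (hq : q = p ^ e) (c : F)
    (hc : c ^ q + c = 0) :
    (gH q F).comp (Polynomial.X + Polynomial.C (Polynomial.C c)) = gH q F := by
  have hadd : ∀ a b : F[X][X], (a + b) ^ q = a ^ q + b ^ q := by
    intro a b; rw [hq]; exact add_pow_char_pow _ _ _ _
  have h2 : (Polynomial.C (Polynomial.C c) : F[X][X]) ^ q + Polynomial.C (Polynomial.C c) = 0 := by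
    rw [← map_pow, ← map_pow, ← map_add, ← map_add, hc]; simp
  simp only [gH, Polynomial.add_comp, Polynomial.pow_comp, Polynomial.X_comp, hadd]
  linear_combination h2

lemma fH_comp (p e : ℕ) [Fact p.Prime] [CharP F p] (hq : q = p ^ e) (c : F)
    (hc : c ^ q + c = 0) :
    (fH q F).comp (Polynomial.X + Polynomial.C (Polynomial.C c)) = fH q F := by
  rw [fH, Polynomial.sub_comp, gH_comp p e hq c hc, Polynomial.C_comp]

lemma gH_natDegree (hq2 : 2 ≤ q) : (gH q F).natDegree = q := by
  unfold gH; rw [Polynomial.natDegree_add_eq_left_of_natDegree_lt] <;> simp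
  omega

lemma fH_prime (hq2 : 2 ≤ q) : Prime (fH q F) := by
  rw [← MulEquiv.prime_iff (Polynomial.Bivariate.swap (R := F)).toMulEquiv,
    ← UniqueFactorizationMonoid.irreducible_iff_prime]
  have h1 : (Polynomial.Bivariate.swap (R := F)).toMulEquiv (fH q F) =
      -(Polynomial.X ^ (q + 1) - Polynomial.C (Polynomial.X ^ q + Polynomial.X)) := by
    show Polynomial.Bivariate.swap (fH q F) = _
    simp only [fH, gH, map_sub, map_add, map_pow, Polynomial.Bivariate.swap_Y,
      Polynomial.Bivariate.swap_X]
    ring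
  rw [h1]
  refine (Associated.irreducible_iff (Associated.neg_left (Associated.refl
    (Polynomial.X ^ (q + 1) - Polynomial.C (Polynomial.X ^ q + Polynomial.X) : F[X][X])))).2 ?_
  set f : F[X][X] := Polynomial.X ^ (q + 1) - Polynomial.C (Polynomial.X ^ q + Polynomial.X) with hf
  have hm : f.Monic := Polynomial.monic_X_pow_sub_C _ (by omega)
  have hd : f.degree = (q + 1 : ℕ) := Polynomial.degree_X_pow_sub_C (by omega) _
  refine Polynomial.irreducible_of_eisenstein_criterion
    (P := Ideal.span {(Polynomial.X : F[X])}) ?_ ?_ ?_ ?_ ?_ hm.isPrimitive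
  · rw [Ideal.span_singleton_prime Polynomial.X_ne_zero]; exact Polynomial.prime_X
  · rw [hm.leadingCoeff, ← Ideal.eq_top_iff_one, Ideal.span_singleton_eq_top]
    exact Polynomial.not_isUnit_X
  · intro n hn
    rw [hd] at hn
    have hn : n < q + 1 := by exact_mod_cast hn
    rw [Ideal.mem_span_singleton, hf, Polynomial.coeff_sub, Polynomial.coeff_X_pow,
      if_neg (by omega), Polynomial.coeff_C]
    split_ifs
    · rw [zero_sub, dvd_neg]
      exact dvd_add (dvd_pow_self _ (by omega)) dvd_rfl
    · simp
  · rw [hd]; exact_mod_cast Nat.succ_pos q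
  · rw [Ideal.span_singleton_pow, Ideal.mem_span_singleton, Polynomial.X_pow_dvd_iff]
    intro h
    have := h 1 (by omega)
    have hq1 : ¬ (1 = q) := by omega
    rw [hf, Polynomial.coeff_sub, Polynomial.coeff_X_pow, if_neg (by omega),
      Polynomial.coeff_C_zero] at this
    simp [Polynomial.coeff_X_pow, Polynomial.coeff_X, hq1] at this

open Classical in
lemma roots_facts [Fintype F] (p e : ℕ) [Fact p.Prime] [CharP F p] (hq : q = p ^ e) (hq2 : 2 ≤ q)
    (hF : Fintype.card F = q ^ 2) :
    ∃ S : Finset F, (∀ c, c ∈ S ↔ c ^ q + c = 0) ∧ S.card = q ∧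
      gH q F = ∏ c ∈ S, (Polynomial.X - Polynomial.C (Polynomial.C c)) := by
  set g : F[X] := Polynomial.X ^ q + Polynomial.X with hg
  have hdeg : g.natDegree = q := by
    rw [hg]; rw [Polynomial.natDegree_add_eq_left_of_natDegree_lt] <;> simp
    omega
  have hmon : g.Monic := by
    rw [hg]; apply Polynomial.monic_X_pow_add
    simp; omega
  have hdvd : g ∣ Polynomial.X ^ (Fintype.card F) - Polynomial.X := by
    have : Polynomial.X ^ (Fintype.card F) - Polynomial.X = g ^ q - g := by
      have hadd : ∀ a b : F[X], (a + b) ^ q = a ^ q + b ^ q := by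
        intro a b; rw [hq]; exact add_pow_char_pow _ _ _ _
      rw [hg, hadd, hF]; ring
    rw [this]
    exact dvd_sub (dvd_pow_self _ (by omega)) dvd_rfl
  have h0 : (Polynomial.X ^ (Fintype.card F) - Polynomial.X : F[X]) ≠ 0 :=
    FiniteField.X_pow_card_sub_X_ne_zero F Fintype.one_lt_card
  have hsp0 : (Polynomial.X ^ (Fintype.card F) - Polynomial.X : F[X]).Splits := by
    rw [Polynomial.splits_iff_card_roots, FiniteField.roots_X_pow_card_sub_X,
      FiniteField.X_pow_card_sub_X_natDegree_eq F Fintype.one_lt_card]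
    rfl
  have hsp : g.Splits := hsp0.of_dvd h0 hdvd
  have hnd : g.roots.Nodup := by
    refine Multiset.nodup_of_le (Polynomial.roots.le_of_dvd h0 hdvd) ?_
    rw [FiniteField.roots_X_pow_card_sub_X]
    exact Finset.univ.nodup
  refine ⟨⟨g.roots, hnd⟩, ?_, ?_, ?_⟩
  · intro c
    rw [Finset.mem_mk, Polynomial.mem_roots hmon.ne_zero]
    simp [hg]
  · rw [Finset.card_mk, ← hsp.natDegree_eq_card_roots, hdeg]
  · have h1 := hsp.eq_prod_roots_of_monic hmon
    have h2 : g = ∏ c ∈ (⟨g.roots, hnd⟩ : Finset F), (Polynomial.X - Polynomial.C c) := h1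
    have h3 := congrArg (Polynomial.map Polynomial.C) h2
    rw [Polynomial.map_prod] at h3
    simpa [hg, gH] using h3

lemma gH_quot_wle (hq2 : 2 ≤ q) {P : F[X][X]} {a : F[X]} {n : ℕ}
    (h : WleH q 0 (Polynomial.C a + gH q F * P) n) : WleH q q P n := by
  intro i j
  -- downward induction on `j`
  induction hN : P.natDegree + 1 - j using Nat.strong_induction_on generalizing i j with
  | _ N ih =>
    intro hij
    have hjle : j ≤ P.natDegree := by
      by_contra hlt
      rw [Polynomial.coeff_eq_zero_of_natDegree_lt (p := P) (by omega)] at hij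
      simp at hij
    have hco : (Polynomial.C a + gH q F * P).coeff (j + q) = P.coeff j + P.coeff (j + q - 1) := by
      obtain ⟨r, hr⟩ : ∃ r, j + q = r + 1 := ⟨j + q - 1, by omega⟩
      rw [Polynomial.coeff_add, Polynomial.coeff_C, if_neg (by omega), zero_add, gH, add_mul,
        Polynomial.coeff_add, mul_comm (Polynomial.X ^ q), Polynomial.coeff_mul_X_pow]
      rw [hr, mul_comm Polynomial.X, Polynomial.coeff_mul_X]
      simp
    by_cases h1 : (P.coeff (j + q - 1)).coeff i = 0
    · have := h i (j + q) (by rw [hco, Polynomial.coeff_add, h1, add_zero]; exact hij)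
      simpa using this
    · have := ih _ (by omega) i (j + q - 1) rfl h1
      refine le_trans ?_ this
      gcongr
      omega

lemma reduce_inv (p e : ℕ) [Fact p.Prime] [CharP F p] (hq : q = p ^ e) (hq2 : 2 ≤ q)
    (S : Finset F) (hS : ∀ c, c ∈ S ↔ c ^ q + c = 0)
    (hg : gH q F = ∏ c ∈ S, (Polynomial.X - Polynomial.C (Polynomial.C c))) (N : ℕ) :
    ∀ (P : F[X][X]) (n : ℕ), P.natDegree ≤ N →
    (∀ c ∈ S, P.comp (Polynomial.X + Polynomial.C (Polynomial.C c)) = P) → WleH q 0 P n →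
    ∃ G : F[X], fH q F ∣ P - Polynomial.C G ∧ ∀ i, G.coeff i ≠ 0 → q * i ≤ n := by
  induction N using Nat.strong_induction_on with
  | _ N ih =>
    intro P n hPN hinv hw
    have hg0 : gH q F ≠ 0 := by
      intro h
      have := gH_natDegree (F := F) hq2
      rw [h] at this
      simp at this
      omega
    have hdvd : gH q F ∣ P - Polynomial.C (P.eval 0) := by
      rw [hg]
      apply Finset.prod_dvd_of_coprime
      · intro a _ b _ hab
        have := (Polynomial.pairwise_coprime_X_sub_C (K := F) Function.injective_id hab).map
          (Polynomial.mapRingHom (Polynomial.C : F →+* F[X]))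
        simpa using this
      · intro c hc
        rw [Polynomial.dvd_iff_isRoot, Polynomial.IsRoot, Polynomial.eval_sub, Polynomial.eval_C,
          sub_eq_zero]
        conv_rhs => rw [← hinv c hc]
        simp [Polynomial.eval_comp]
    obtain ⟨P', hP'⟩ := hdvd
    have hP : P = Polynomial.C (P.eval 0) + gH q F * P' := by rw [← hP']; ring
    have hca : ∀ i, (P.eval 0).coeff i ≠ 0 → q * i ≤ n := by
      intro i hi
      rw [← Polynomial.coeff_zero_eq_eval_zero] at hi
      simpa using hw i 0 hi
    generalize P.eval 0 = a at *
    have hw' : WleH q q P' n := gH_quot_wle hq2 (a := a) (by rw [← hP]; exact hw)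
    have hfg : fH q F ∣ gH q F - Polynomial.C (Polynomial.X ^ (q + 1)) := dvd_rfl
    by_cases h0 : P' = 0
    · refine ⟨a, ?_, hca⟩
      rw [hP', h0]; simp
    · have hn : q * (q + 1) ≤ n := by
        have h1 : P'.leadingCoeff.leadingCoeff ≠ 0 := by simpa using h0
        have := hw' _ _ h1
        nlinarith
      have hdeg : P'.natDegree + q = P.natDegree := by
        rw [hP, add_comm (Polynomial.C a), Polynomial.natDegree_add_C,
          Polynomial.natDegree_mul hg0 h0, gH_natDegree hq2, add_comm]
      obtain ⟨G', hG', hGc⟩ := ih (P'.natDegree) (by omega) P' (n - q * (q + 1)) le_rfl (by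
        intro c hc
        have h1 := hinv c hc
        rw [hP, Polynomial.add_comp, Polynomial.C_comp, Polynomial.mul_comp,
          gH_comp p e hq c ((hS c).1 hc)] at h1
        exact mul_left_cancel₀ hg0 (add_left_cancel h1)) (by
        intro i j hij
        have := hw' i j hij
        apply Nat.le_sub_of_add_le
        nlinarith)
      refine ⟨a + Polynomial.X ^ (q + 1) * G', ?_, ?_⟩
      · have : P - Polynomial.C (a + Polynomial.X ^ (q + 1) * G') =
            (gH q F - Polynomial.C (Polynomial.X ^ (q + 1))) * P' +
            Polynomial.C (Polynomial.X ^ (q + 1)) * (P' - Polynomial.C G') := by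
          rw [map_add, map_mul]
          linear_combination hP'
        rw [this]
        exact dvd_add (hfg.mul_right _) (hG'.mul_left _)
      · intro i hi
        by_cases h1 : a.coeff i = 0
        · rw [Polynomial.coeff_add, h1, zero_add, Polynomial.coeff_X_pow_mul'] at hi
          split_ifs at hi with hle
          · have := hGc _ hi
            obtain ⟨r, rfl⟩ := Nat.exists_eq_add_of_le hle
            simp only [Nat.add_sub_cancel_left] at this
            have := Nat.add_le_of_le_sub hn this
            nlinarith
          · exact absurd rfl hi
        · exact hca i h1

lemma mainH [Fintype F] (p e : ℕ) [Fact p.Prime] [CharP F p] (hq : q = p ^ e) (hq2 : 2 ≤ q)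
    (hF : Fintype.card F = q ^ 2) (R : F[X][X]) (D k : ℕ) (hR : WleH q 0 R D) (hk : D < k)
    (hd : (PowerSeries.X : PowerSeries F) ^ k ∣ psiH q F R) : fH q F ∣ R := by
  obtain ⟨S, hS, hcard, hg⟩ := roots_facts (F := F) p e hq hq2 hF
  have hadd : ∀ a b : F, (a + b) ^ q = a ^ q + b ^ q := by
    intro a b; rw [hq]; exact add_pow_char_pow _ _ _ _
  have hneg : ∀ a : F, (-a) ^ q = - a ^ q := by
    intro a; rw [neg_pow, hq, neg_one_pow_char_pow]; ring
  set T : F → F[X][X] := fun c => R.comp (Polynomial.X + Polynomial.C (Polynomial.C c)) with hT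
  have hTT : ∀ c d, (T c).comp (Polynomial.X + Polynomial.C (Polynomial.C d)) = T (c + d) := by
    intro c d
    simp only [hT, Polynomial.comp_assoc]
    congr 1
    simp
    ring
  have hT0 : T 0 = R := by simp [hT]
  obtain ⟨G, hG, hGc⟩ := reduce_inv p e hq hq2 S hS hg _ (∏ c ∈ S, T c) (q * D) le_rfl (by
    intro d hdS
    rw [Polynomial.prod_comp]
    simp only [hTT]
    refine Finset.prod_bij (fun c _ => c + d) ?_ ?_ ?_ ?_
    · intro c hc
      rw [hS] at *
      rw [hadd]; linear_combination hc + hdS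
    · intro a _ b _ h; exact add_right_cancel h
    · intro b hb
      refine ⟨b - d, ?_, by ring⟩
      rw [hS] at *
      rw [sub_eq_add_neg, hadd, hneg]; linear_combination hb - hdS
    · intro c hc; rfl) (by
    rw [← hcard]
    conv => arg 1; rw [hcard]
    exact WleH.prod _ _ fun c _ => hR.comp c)
  have hG0 : G = 0 := by
    have h1 : psiH q F (∏ c ∈ S, T c) = (G : PowerSeries F) := by
      obtain ⟨U, hU⟩ := hG
      have := congrArg (psiH q F) hU
      rw [map_sub, map_mul, psiH_fH p e hq hq2, zero_mul, sub_eq_zero] at this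
      rw [this]
      simp [psiH]
    have h2 : (PowerSeries.X : PowerSeries F) ^ k ∣ (G : PowerSeries F) := by
      rw [← h1, map_prod]
      refine hd.trans ?_
      rw [← hT0]
      exact Finset.dvd_prod_of_mem (fun c => psiH q F (T c))
        ((hS 0).2 (by simp; omega))
    rw [PowerSeries.X_pow_dvd_iff] at h2
    ext i
    by_contra hi
    have h3 := hGc i (by simpa using hi)
    have h4 : i ≤ D := Nat.le_of_mul_le_mul_left h3 (by omega)
    have := h2 i (by omega)
    rw [Polynomial.coeff_coe] at this
    exact hi (by simpa using this)
  rw [hG0, map_zero, sub_zero] at hG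
  obtain ⟨c, hc, hdv⟩ := (fH_prime hq2).exists_mem_finset_dvd hG
  have hc' := (hS c).1 hc
  have hdv2 : (fH q F).comp (Polynomial.X + Polynomial.C (Polynomial.C (-c))) ∣
      (T c).comp (Polynomial.X + Polynomial.C (Polynomial.C (-c))) := by
    obtain ⟨U, hU⟩ := hdv
    rw [hU, Polynomial.mul_comp]
    exact dvd_mul_right _ _
  rw [fH_comp p e hq (-c) (by rw [hneg]; linear_combination -hc'), hTT] at hdv2
  simpa [hT0] using hdv2

end

/-- Let `F` be the field with `q²` elements, `q = p^e`.  Let `Q_0, …, Q_ℓ ∈ F[x,y]` have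
`y`-degree at most `q - 1`, not all zero, and let `h ∈ F[x,y]` have `y`-degree at most
`q - 1` and weighted degree `deg_{q,q+1} h ≤ m`.  If `k > max_t (deg_{q,q+1} Q_t + t·m)`
and `X^k` divides the power series `Σ_t Q_t(X,Y)·h(X,Y)^t` (where `Y = Σ_b (-1)^b
X^{(q+1)q^b}`), then `Σ_t Q_t·h^t` lies in the ideal generated by `y^q + y - x^(q+1)`. -/
theorem stmt_13 (p e : ℕ) (hp : p.Prime) (he : 0 < e) (q : ℕ) (hq : q = p ^ e)
    (F : Type) [Field F] [Fintype F] (hF : Fintype.card F = q ^ 2)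
    (m k ℓ : ℕ) (Q : Fin (ℓ + 1) → MvPolynomial (Fin 2) F)
    (hQy : ∀ t, MvPolynomial.degreeOf 1 (Q t) ≤ q - 1)
    (hQ0 : ∃ t, Q t ≠ 0)
    (h : MvPolynomial (Fin 2) F)
    (hhy : MvPolynomial.degreeOf 1 h ≤ q - 1)
    (hhdeg : MvPolynomial.weightedTotalDegree ![q, q + 1] h ≤ m)
    (hk : Finset.univ.sup
      (fun t : Fin (ℓ + 1) =>
        MvPolynomial.weightedTotalDegree ![q, q + 1] (Q t) + (t : ℕ) * m) < k)
    (hdvd : (PowerSeries.X : PowerSeries F) ^ k ∣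
      ∑ t : Fin (ℓ + 1), MvPolynomial.aeval ![PowerSeries.X, Yser q F] (Q t) *
        (MvPolynomial.aeval ![PowerSeries.X, Yser q F] h) ^ (t : ℕ)) :
    (∑ t : Fin (ℓ + 1), Q t * h ^ (t : ℕ)) ∈
      Ideal.span {(X 1 : MvPolynomial (Fin 2) F) ^ q + X 1 - (X 0) ^ (q + 1)} := by
  haveI : Fact p.Prime := ⟨hp⟩
  have hq2 : 2 ≤ q := by
    rw [hq]
    calc 2 ≤ p := hp.two_le
      _ ≤ p ^ e := Nat.le_self_pow (by omega) p
  haveI : CharP F p := charP_of_card_eq_prime_pow (p := p) (f := e * 2)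
    (by rw [hF, hq, ← pow_mul])
  have hmain := mainH (F := F) p e hq hq2 hF
    (phiH F (∑ t : Fin (ℓ + 1), Q t * h ^ (t : ℕ))) _ k (by
      rw [map_sum]
      refine WleH.sum _ _ fun t _ => ?_
      rw [map_mul, map_pow]
      refine WleH.mono ((phiH_wle (Q t)).mul (((phiH_wle h).mono hhdeg).pow (t : ℕ))) ?_
      exact Finset.le_sup (f := fun t : Fin (ℓ + 1) =>
        MvPolynomial.weightedTotalDegree ![q, q + 1] (Q t) + (t : ℕ) * m) (Finset.mem_univ t)) hk
    (by
      rw [psiH_phiH]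
      simpa using hdvd)
  rw [Ideal.mem_span_singleton]
  have h1 := map_dvd (chiH F) hmain
  rw [chiH_phiH] at h1
  rw [fH, gH, map_pow] at h1
  simpa [chiH, -map_pow, Polynomial.eval₂_pow] using h1
end

section
/- Let m be an integer with q² − q − 2 < m < q³, and let C be the F-linear subspace of the space of F-valued functions on the q³ points of the Hermitian curve consisting of all evaluation vectors ( f(P) )_{P on the curve} where f ranges over the polynomials in F[x, y] with deg_y f ≤ q − 1 and deg_{q,q+1}(f) ≤ m. Then C has dimension m − g + 1 over F, and every nonzero element of C is nonzero in at least q³ − m coordinates. -/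
def hV {F A : Type*} [Field F] [CommRing A] [Algebra F A] (x y : A) (q n : ℕ) : Submodule F A :=
  Submodule.span F {z | ∃ i j : ℕ, q * i + (q + 1) * j < n ∧ z = x ^ i * y ^ j}

section core
variable {F A : Type*} [Field F] [CommRing A] [Algebra F A] (x y : A) (q : ℕ)

lemma hV_mem {i j n : ℕ} (h : q * i + (q + 1) * j < n) : x ^ i * y ^ j ∈ hV (F := F) x y q n :=
  Submodule.subset_span ⟨i, j, h, rfl⟩

lemma hV_mono {n k : ℕ} (h : n ≤ k) : hV (F := F) x y q n ≤ hV x y q k := by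
  apply Submodule.span_mono
  rintro z ⟨i, j, h1, rfl⟩
  exact ⟨i, j, by omega, rfl⟩

lemma hV_mul {n : ℕ} (u : A) (hu : u ∈ hV (F := F) x y q n) (i j : ℕ) :
    x ^ i * y ^ j * u ∈ hV (F := F) x y q (n + (q * i + (q + 1) * j)) := by
  unfold hV at hu
  induction hu using Submodule.span_induction with
  | mem z hz =>
    obtain ⟨a, b, h, rfl⟩ := hz
    have : x ^ i * y ^ j * (x ^ a * y ^ b) = x ^ (a + i) * y ^ (b + j) := by ring
    rw [this]
    apply hV_mem
    nlinarith
  | zero => simp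
  | add a b _ _ ha hb => rw [mul_add]; exact add_mem ha hb
  | smul c a _ ha => rw [mul_smul_comm]; exact Submodule.smul_mem _ _ ha

lemma hV_cong (hq : 2 ≤ q) (hxy : y ^ q + y = x ^ (q + 1)) (i j k : ℕ) :
    x ^ i * y ^ (j + q * k) - x ^ (i + (q + 1) * k) * y ^ j ∈
      hV (F := F) x y q (q * i + (q + 1) * (j + q * k)) := by
  induction k generalizing i with
  | zero => simp
  | succ k ih =>
    have h1 := ih (i + (q + 1))
    have e1 : x ^ i * y ^ (j + q * (k + 1)) - x ^ (i + (q + 1) * (k + 1)) * y ^ j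
        = (x ^ (i + (q + 1)) * y ^ (j + q * k) - x ^ (i + (q + 1) + (q + 1) * k) * y ^ j)
          - x ^ i * y ^ (j + q * k + 1) := by
      have : y ^ q = x ^ (q + 1) - y := by rw [← hxy]; ring
      rw [show j + q * (k + 1) = (j + q * k) + q by ring, pow_add _ _ q, this]
      ring
    rw [e1]
    refine sub_mem (hV_mono x y q (le_of_eq ?_) h1) (hV_mem x y q ?_)
    · ring
    · nlinarith

lemma hV_key (hq : 2 ≤ q) (hxy : y ^ q + y = x ^ (q + 1)) (a b : ℕ)
    (hab : x ^ a * y ^ b ∈ hV (F := F) x y q (q * a + (q + 1) * b)) (i j i0 j0 : ℕ)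
    (h : q * i + (q + 1) * j = (q * a + (q + 1) * b) + (q * i0 + (q + 1) * j0)) :
    x ^ i * y ^ j ∈ hV (F := F) x y q (q * i + (q + 1) * j) := by
  have h1 := hV_mul x y q _ hab i0 j0
  rw [← h, show x ^ i0 * y ^ j0 * (x ^ a * y ^ b) = x ^ (a + i0) * y ^ (b + j0) by ring] at h1
  have h' : q * i + (q + 1) * j = q * (a + i0) + (q + 1) * (b + j0) := by rw [h]; ring
  generalize a + i0 = i' at *
  generalize b + j0 = j' at *
  have key : ∀ i j i' j' : ℕ, j ≤ j' → q * i + (q + 1) * j = q * i' + (q + 1) * j' →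
      ∃ k, j' = j + q * k ∧ i = i' + (q + 1) * k := by
    intro i j i' j' hj he
    obtain ⟨d, rfl⟩ := Nat.exists_eq_add_of_le hj
    have h2 : q * i = q * i' + (q + 1) * d := by nlinarith
    have h3 : q ∣ (q + 1) * d := by
      rw [← Nat.dvd_add_right (Dvd.intro i' rfl), ← h2]; exact Dvd.intro _ rfl
    have h4 : q ∣ d := Nat.Coprime.dvd_of_dvd_mul_left (by simp) h3
    obtain ⟨k, rfl⟩ := h4
    refine ⟨k, rfl, ?_⟩
    apply Nat.eq_of_mul_eq_mul_left (show 0 < q by omega)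
    rw [h2]; ring
  rcases le_total j j' with hj | hj
  · obtain ⟨k, rfl, rfl⟩ := key i j i' j' hj h'
    have h5 := hV_cong (F := F) x y q hq hxy i' j k
    rw [← h'] at h5
    simpa using sub_mem h1 h5
  · obtain ⟨k, rfl, rfl⟩ := key i' j' i j hj h'.symm
    have h5 := hV_cong (F := F) x y q hq hxy i j' k
    simpa using add_mem h1 h5

lemma h_core (hq : 2 ≤ q) (hxy : y ^ q + y = x ^ (q + 1)) (a b : ℕ)
    (hab : x ^ a * y ^ b ∈ hV (F := F) x y q (q * a + (q + 1) * b))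
    (htop : ∀ z : A, ∃ n, z ∈ hV (F := F) x y q n) :
    Module.finrank F A ≤ q * a + (q + 1) * b := by
  set w := q * a + (q + 1) * b with hw
  let wt : ℕ × ℕ → ℕ := fun d => q * d.1 + (q + 1) * d.2
  let B : Set (ℕ × ℕ) := {d | d.2 < q ∧ ∀ i0 j0 : ℕ, wt d ≠ w + (q * i0 + (q + 1) * j0)}
  have hw0 : ∀ d ∈ B, 0 < w := by
    rintro ⟨i, j⟩ ⟨-, h⟩
    rcases Nat.eq_zero_or_pos w with h0 | h0
    · exact absurd (by simp [wt, h0]) (h i j)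
    · exact h0
  have hmaps : ∀ d ∈ B, wt d % w ∈ (Finset.range w : Set ℕ) := by
    intro d hd
    simpa using Nat.mod_lt _ (hw0 d hd)
  have aux : ∀ d ∈ B, ∀ d' ∈ B, wt d % w = wt d' % w → wt d' ≤ wt d := by
    intro d hd d' hd' h
    by_contra hlt
    push Not at hlt
    obtain ⟨k, hk⟩ := (Nat.modEq_iff_dvd' hlt.le).1 h
    have hk0 : k ≠ 0 := by rintro rfl; simp at hk; omega
    obtain ⟨k, rfl⟩ := Nat.exists_eq_succ_of_ne_zero hk0
    apply hd'.2 (d.1 + k * a) (d.2 + k * b)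
    have : wt d' = wt d + w * (k + 1) := by simp only [Nat.succ_eq_add_one] at hk; omega
    rw [this]; simp only [wt, hw]; ring
  have wtinj : ∀ d ∈ B, ∀ d' ∈ B, wt d = wt d' → d = d' := by
    rintro ⟨i, j⟩ ⟨h1, -⟩ ⟨i', j'⟩ ⟨h2, -⟩ h
    simp only [wt] at h h1 h2
    have hj : j = j' := by
      have := congrArg (· % q) (show q * (i + j) + j = q * (i' + j') + j' by linarith)
      simpa [Nat.mod_eq_of_lt h1, Nat.mod_eq_of_lt h2] using this
    subst hj
    have : i = i' := Nat.eq_of_mul_eq_mul_left (show 0 < q by omega) (by omega)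
    rw [this]
  have hinj : Set.InjOn (fun d => wt d % w) B := fun d hd d' hd' h =>
    wtinj d hd d' hd' (le_antisymm (aux d' hd' d hd h.symm) (aux d hd d' hd' h))
  have hfin : B.Finite := Set.Finite.of_injOn hmaps hinj (Finset.finite_toSet _)
  have hcard : B.ncard ≤ w := by
    have := Set.ncard_le_ncard_of_injOn _ hmaps hinj (Finset.finite_toSet _)
    simpa using this
  let φ : ℕ × ℕ → A := fun d => x ^ d.1 * y ^ d.2
  have hspan : ∀ n, hV (F := F) x y q n ≤ Submodule.span F (φ '' B) := by
    intro n
    induction n with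
    | zero =>
      rw [hV, Submodule.span_le]; rintro z ⟨i, j, h, -⟩; omega
    | succ n ih =>
      rw [hV, Submodule.span_le]; rintro z ⟨i, j, h, rfl⟩
      have ih' : hV (F := F) x y q (q * i + (q + 1) * j) ≤ Submodule.span F (φ '' B) :=
        (hV_mono x y q (by omega)).trans ih
      by_cases hB : ∃ i0 j0, q * i + (q + 1) * j = w + (q * i0 + (q + 1) * j0)
      · obtain ⟨i0, j0, hB⟩ := hB
        exact ih' (hV_key x y q hq hxy a b hab i j i0 j0 hB)
      · push Not at hB
        have hc := hV_cong (F := F) x y q hq hxy i (j % q) (j / q)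
        rw [Nat.mod_add_div] at hc
        have hmem : x ^ (i + (q + 1) * (j / q)) * y ^ (j % q) ∈ Submodule.span F (φ '' B) := by
          apply Submodule.subset_span
          refine ⟨(i + (q + 1) * (j / q), j % q), ⟨Nat.mod_lt _ (by omega), ?_⟩, rfl⟩
          intro i0 j0 he
          apply hB i0 j0
          rw [← he]
          conv_lhs => rw [← Nat.mod_add_div j q]
          simp only [wt]; ring
        simpa using add_mem (ih' hc) hmem
  have htop' : Submodule.span F (φ '' B) = ⊤ := by
    rw [eq_top_iff]
    intro z _
    obtain ⟨n, hn⟩ := htop z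
    exact hspan n hn
  have hfi : (φ '' B).Finite := hfin.image _
  calc Module.finrank F A = Module.finrank F (⊤ : Submodule F A) := finrank_top F A |>.symm
    _ = Module.finrank F (Submodule.span F (hfi.toFinset : Set A)) := by
      rw [hfi.coe_toFinset, htop']
    _ ≤ hfi.toFinset.card := finrank_span_finset_le_card _
    _ = (φ '' B).ncard := (Set.ncard_eq_toFinset_card _ hfi).symm
    _ ≤ B.ncard := Set.ncard_image_le hfin
    _ ≤ w := hcard
end core

section app
variable {F : Type} [Field F] [Fintype F]

abbrev HC (F : Type) [Field F] (q : ℕ) := {P : F × F // P.2 ^ q + P.2 = P.1 ^ (q + 1)}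

lemma h_zeros (q : ℕ) (hq : 2 ≤ q) (f : MvPolynomial (Fin 2) F) (hf : f ≠ 0) (m : ℕ)
    (hsup : ∀ d ∈ f.support, d 1 < q ∧ q * d 0 + (q + 1) * d 1 ≤ m)
    (Z : Set (HC F q))
    (hZ : ∀ P ∈ Z, MvPolynomial.eval ![P.1.1, P.1.2] f = 0) : Z.ncard ≤ m := by
  classical
  let x : Z → F := fun P => P.1.1.1
  let y : Z → F := fun P => P.1.1.2
  have hxy : y ^ q + y = x ^ (q + 1) := by
    funext P; exact P.1.2
  have hev : ∀ g : MvPolynomial (Fin 2) F, (fun P : Z => MvPolynomial.eval ![P.1.1.1, P.1.1.2] g)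
      = ∑ d ∈ g.support, g.coeff d • (x ^ (d 0) * y ^ (d 1)) := by
    intro g
    funext P
    rw [MvPolynomial.eval_eq']
    simp [Fin.prod_univ_two, x, y]
  have htop : ∀ z : Z → F, ∃ n, z ∈ hV (F := F) x y q n := by
    intro z
    let z' : (Fin 2 → F) → F := fun v => if h : ∃ P : Z, ![P.1.1.1, P.1.1.2] = v then z h.choose else 0
    have hz' : ∀ P : Z, z' ![P.1.1.1, P.1.1.2] = z P := by
      intro P
      have h : ∃ P' : Z, ![P'.1.1.1, P'.1.1.2] = ![P.1.1.1, P.1.1.2] := ⟨P, rfl⟩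
      simp only [z', dif_pos h]
      congr 1
      have h2 := h.choose_spec
      apply Subtype.ext; apply Subtype.ext
      apply Prod.ext
      · simpa using congrFun h2 0
      · simpa using congrFun h2 1
    have : z' ∈ (MvPolynomial.restrictDegree (Fin 2) F (Fintype.card F - 1)).map (MvPolynomial.evalₗ F (Fin 2)) := by
      rw [MvPolynomial.map_restrict_dom_evalₗ]; trivial
    obtain ⟨g, -, hg⟩ := this
    have hz : z = ∑ d ∈ g.support, g.coeff d • (x ^ (d 0) * y ^ (d 1)) := by
      rw [← hev]; funext P; rw [← hz', ← hg]; rfl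
    refine ⟨(g.support.sup fun d => q * d 0 + (q + 1) * d 1) + 1, ?_⟩
    rw [hz]
    refine Submodule.sum_mem _ fun d hd => Submodule.smul_mem _ _ (hV_mem x y q ?_)
    exact Nat.lt_succ_of_le (Finset.le_sup (f := fun d : Fin 2 →₀ ℕ => q * d 0 + (q + 1) * d 1) hd)
  obtain ⟨d, hd, hmax⟩ := Finset.exists_max_image f.support
    (fun d => q * d 0 + (q + 1) * d 1) (MvPolynomial.support_nonempty.2 hf)
  have h0 : ∑ d ∈ f.support, f.coeff d • (x ^ (d 0) * y ^ (d 1)) = 0 := by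
    rw [← hev]; funext P; exact hZ P.1 P.2
  rw [← Finset.add_sum_erase _ _ hd] at h0
  have hab : x ^ d 0 * y ^ d 1 ∈ hV (F := F) x y q (q * d 0 + (q + 1) * d 1) := by
    have hc : f.coeff d ≠ 0 := MvPolynomial.mem_support_iff.1 hd
    rw [← Submodule.smul_mem_iff _ hc, eq_neg_of_add_eq_zero_left h0]
    refine Submodule.neg_mem _ (Submodule.sum_mem _ fun d' hd' =>
      Submodule.smul_mem _ _ (hV_mem x y q ?_))
    rw [Finset.mem_erase] at hd'
    refine lt_of_le_of_ne (hmax d' hd'.2) fun he => hd'.1 ?_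
    have h1 := (hsup d hd).1
    have h2 := (hsup d' hd'.2).1
    have hj : d' 1 = d 1 := by
      have := congrArg (· % q) (show q * (d' 0 + d' 1) + d' 1 = q * (d 0 + d 1) + d 1 by linarith)
      simpa [Nat.mod_eq_of_lt h1, Nat.mod_eq_of_lt h2] using this
    have hi : d' 0 = d 0 := by
      rw [hj] at he
      exact Nat.eq_of_mul_eq_mul_left (show 0 < q by omega) (by omega)
    ext i; fin_cases i
    · exact hi
    · exact hj
  have := h_core x y q hq hxy _ _ hab htop
  rw [Module.finrank_fintype_fun_eq_card, ← Nat.card_eq_fintype_card, Nat.card_coe_set_eq] at this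
  exact this.trans (hsup d hd).2

lemma h_points (p e q : ℕ) (hp : p.Prime) (he : 0 < e) (hq : q = p ^ e)
    (hF : Fintype.card F = q ^ 2) : q ^ 3 ≤ Nat.card (HC F q) := by
  classical
  have hq2 : 2 ≤ q := by
    rw [hq]; exact hp.two_le.trans (Nat.le_self_pow he.ne' p)
  have : Fact p.Prime := ⟨hp⟩
  have : CharP F p := charP_of_card_eq_prime_pow (f := e * 2) (by rw [hF, hq, pow_mul])
  let T : F →+ F :=
    { toFun := fun b => b ^ q + b
      map_zero' := by simp; omega
      map_add' := fun a b => by rw [hq, add_pow_char_pow]; ring }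
  have hfrob : ∀ a : F, a ^ (q * q) = a := fun a => by
    rw [← sq, ← hF, FiniteField.pow_card]
  -- fixed set
  let Fix : Finset F := Finset.univ.filter fun c => c ^ q = c
  have hFix : Fix.card ≤ q := by
    let P : Polynomial F := Polynomial.X ^ q - Polynomial.X
    have hP : P ≠ 0 := FiniteField.X_pow_card_sub_X_ne_zero F (by omega)
    have hd : P.natDegree = q := FiniteField.X_pow_card_sub_X_natDegree_eq F (by omega)
    rw [← hd]
    apply Polynomial.card_le_degree_of_subset_roots
    intro c hc
    rw [Polynomial.mem_roots hP]
    have : c ^ q = c := by simpa [Fix] using hc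
    simp [P, this]
  have hker : Nat.card T.ker ≤ q := by
    let P : Polynomial F := Polynomial.X ^ q + Polynomial.X
    have hd : P.natDegree = q := by
      simp only [P]; compute_degree <;> first | omega | skip
      rw [if_neg (by omega)]; simp
    have hP : P ≠ 0 := by rintro h; rw [h] at hd; simp at hd; omega
    have : (Finset.univ.filter fun b : F => T b = 0).card ≤ P.natDegree := by
      apply Polynomial.card_le_degree_of_subset_roots
      intro c hc
      rw [Polynomial.mem_roots hP]
      have : c ^ q + c = 0 := by simpa [T] using hc
      simp [P, this]
    rw [hd] at this
    refine le_trans (le_of_eq ?_) this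
    rw [← Fintype.card_subtype, ← Nat.card_eq_fintype_card]
    rfl
  have hsub : Set.range T ⊆ (Fix : Set F) := by
    rintro _ ⟨b, rfl⟩
    simp only [Fix, Finset.coe_filter, Finset.mem_univ, true_and, Set.mem_ofPred_eq]
    show (b ^ q + b) ^ q = b ^ q + b
    conv_lhs => rw [hq, add_pow_char_pow, ← hq, ← pow_mul, hfrob]
    ring
  have hmul : Nat.card T.ker * Nat.card T.range = q ^ 2 := by
    rw [← hF, ← Nat.card_eq_fintype_card (α := F), ← AddSubgroup.card_mul_index T.ker, AddSubgroup.index_ker]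
  have hrange : Nat.card T.range ≤ Fix.card := by
    have := Set.ncard_le_ncard hsub (Finset.finite_toSet _)
    rw [Set.ncard_coe_finset] at this
    exact this
  have hr : Nat.card T.range = q := by nlinarith
  have hk : Nat.card T.ker = q := by
    rw [hr, sq] at hmul
    exact Nat.eq_of_mul_eq_mul_right (by omega) hmul
  have heq : Set.range T = (Fix : Set F) := by
    apply Set.eq_of_subset_of_ncard_le hsub _ (Finset.finite_toSet _)
    rw [Set.ncard_coe_finset]
    exact hFix.trans (le_of_eq hr.symm)
  have hsec : ∀ a : F, ∃ b, T b = a ^ (q + 1) := by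
    intro a
    have : a ^ (q + 1) ∈ Set.range T := by
      rw [heq]
      simp only [Fix, Finset.coe_filter, Finset.mem_univ, true_and, Set.mem_ofPred_eq]
      rw [← pow_mul, add_mul, pow_add, hfrob]; ring
    exact this
  choose s hs using hsec
  let ι : F × T.ker → HC F q := fun u => ⟨(u.1, s u.1 + u.2), by
    have h : T (s u.1 + u.2) = u.1 ^ (q + 1) := by
      rw [map_add, hs, u.2.2, add_zero]
    exact h⟩
  have hι : Function.Injective ι := by
    rintro ⟨a, k⟩ ⟨a', k'⟩ h
    have h1 := congrArg Subtype.val h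
    simp only [ι, Prod.mk.injEq] at h1
    obtain ⟨rfl, h2⟩ := h1
    simp only [add_right_inj] at h2
    rw [Subtype.ext h2]
  calc q ^ 3 = Nat.card (F × T.ker) := by
        rw [Nat.card_prod, hk, Nat.card_eq_fintype_card, hF]; ring
    _ ≤ _ := Nat.card_le_card_of_injective ι hι

def hSet (q m : ℕ) : Set (Fin 2 →₀ ℕ) := {d | d 1 < q ∧ q * d 0 + (q + 1) * d 1 ≤ m}

lemma h_hermite (q m : ℕ) (hq : 0 < q) : ∑ j ∈ Finset.range q, (m + q - j) / q = m + 1 := by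
  induction m with
  | zero =>
    obtain ⟨k, rfl⟩ := Nat.exists_eq_succ_of_ne_zero hq.ne'
    rw [Finset.sum_range_succ']
    rw [Finset.sum_eq_zero]
    · simp
    · intro j hj
      exact Nat.div_eq_of_lt (by omega)
  | succ m ih =>
    obtain ⟨k, rfl⟩ := Nat.exists_eq_succ_of_ne_zero hq.ne'
    rw [Finset.sum_range_succ'] 
    rw [Finset.sum_range_succ] at ih
    have h1 : ∀ j ∈ Finset.range k, (m + 1 + k.succ - (j + 1)) / k.succ = (m + k.succ - j) / k.succ := by
      intro j hj; congr 1; omega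
    rw [Finset.sum_congr rfl h1]
    have h2 : (m + 1 + k.succ - 0) / k.succ = (m + k.succ - k) / k.succ + 1 := by
      rw [Nat.sub_zero, Nat.add_div_right _ hq]
      congr 2; omega
    omega

lemma h_count (q m : ℕ) (hq : 2 ≤ q) (hm : q ^ 2 - q - 2 < m) :
    Nat.card (hSet q m) = m - q * (q - 1) / 2 + 1 := by
  let S : Finset (Σ _ : ℕ, ℕ) := (Finset.range q).sigma fun j => Finset.range ((m + q - j) / q - j)
  let ψ : (Σ _ : ℕ, ℕ) → (Fin 2 →₀ ℕ) := fun u => Finsupp.equivFunOnFinite.symm ![u.2, u.1]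
  have hψ : Function.Injective ψ := by
    rintro ⟨j, i⟩ ⟨j', i'⟩ h
    have h0 := DFunLike.congr_fun h 0
    have h1 := DFunLike.congr_fun h 1
    simp [ψ] at h0 h1
    subst h0 h1
    rfl
  have hmemS : ∀ i j : ℕ, (⟨j, i⟩ : Σ _ : ℕ, ℕ) ∈ S ↔ j < q ∧ q * i + (q + 1) * j ≤ m := by
    intro i j
    simp only [S, Finset.mem_sigma, Finset.mem_range]
    refine and_congr_right fun hj => ?_
    rw [Nat.lt_sub_iff_add_lt, Nat.lt_iff_add_one_le, Nat.le_div_iff_mul_le (by omega)]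
    have e1 : (i + j + 1) * q = q * i + q * j + q := by ring
    have e2 : (q + 1) * j = q * j + j := by ring
    omega
  have himg : hSet q m = ψ '' (S : Set (Σ _ : ℕ, ℕ)) := by
    ext d
    constructor
    · intro hd
      refine ⟨⟨d 1, d 0⟩, (hmemS _ _).2 hd, ?_⟩
      ext i; fin_cases i <;> simp [ψ]
    · rintro ⟨⟨j, i⟩, h, rfl⟩
      have := (hmemS i j).1 h
      simpa [hSet, ψ] using this
  have hS : Nat.card (hSet q m) = S.card := by
    rw [Nat.card_coe_set_eq, himg, Set.ncard_image_of_injective _ hψ, Set.ncard_coe_finset]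
  rw [hS, Finset.card_sigma]
  simp only [Finset.card_range]
  have hsum : ∑ j ∈ Finset.range q, ((m + q - j) / q - j) + ∑ j ∈ Finset.range q, j = m + 1 := by
    rw [← Finset.sum_add_distrib, ← h_hermite q m (by omega)]
    refine Finset.sum_congr rfl fun j hj => Nat.sub_add_cancel ?_
    rw [Finset.mem_range] at hj
    rw [Nat.le_div_iff_mul_le (by omega)]
    obtain ⟨k, rfl⟩ : ∃ k, q = k + 1 := ⟨q - 1, by omega⟩
    have e1 : (k + 1) ^ 2 = k * (k + 1) + (k + 1) := by ring
    have e2 : j * (k + 1) ≤ k * (k + 1) := Nat.mul_le_mul_right _ (by omega)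
    omega
  have hg : ∑ j ∈ Finset.range q, j = q * (q - 1) / 2 := Finset.sum_range_id q
  have hg2 := Finset.sum_range_id_mul_two q
  have e3 : q ^ 2 = q * (q - 1) + q := by
    obtain ⟨k, rfl⟩ : ∃ k, q = k + 1 := ⟨q - 1, by omega⟩
    simp; ring
  have e4 : 2 ≤ q * (q - 1) := by nlinarith [show 1 ≤ q - 1 by omega]
  omega

end app


/-- Parameters of the one-point Hermitian code.  Let `F` be the field with `q²` elements,
`q = p^e`, and let the Hermitian curve be `β^q + β = α^(q+1)`, with `q³` points and genus
`g = q(q-1)/2`.  Let `2g - 2 < m < q³` and let `C` be the subspace of `F`-valued functions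
on the curve points consisting of the evaluation vectors of polynomials `f ∈ F[x,y]` with
`deg_y f ≤ q - 1` and `deg_{q,q+1} f ≤ m`.  Then `dim C = m - g + 1` and every nonzero
element of `C` is nonzero in at least `q³ - m` coordinates. -/
theorem stmt_19 (p e : ℕ) (hp : p.Prime) (he : 0 < e) (q : ℕ) (hq : q = p ^ e)
    (F : Type) [Field F] [Fintype F] (hF : Fintype.card F = q ^ 2)
    (m : ℕ) (hm1 : q ^ 2 - q - 2 < m) (hm2 : m < q ^ 3)
    (S : Set ({P : F × F // P.2 ^ q + P.2 = P.1 ^ (q + 1)} → F))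
    (hS : S = {v | ∃ f : MvPolynomial (Fin 2) F,
      MvPolynomial.degreeOf 1 f ≤ q - 1 ∧
      MvPolynomial.weightedTotalDegree ![q, q + 1] f ≤ m ∧
      ∀ P : {P : F × F // P.2 ^ q + P.2 = P.1 ^ (q + 1)},
        v P = MvPolynomial.eval ![(P : F × F).1, (P : F × F).2] f}) :
    Module.finrank F (Submodule.span F S) = m - q * (q - 1) / 2 + 1 ∧
    ∀ v ∈ Submodule.span F S, v ≠ 0 →
      q ^ 3 - m ≤ Set.ncard {P : {P : F × F // P.2 ^ q + P.2 = P.1 ^ (q + 1)} | v P ≠ 0} := by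
  classical
  have hq2 : 2 ≤ q := by
    rw [hq]; exact hp.two_le.trans (Nat.le_self_pow he.ne' p)
  have hpts : q ^ 3 ≤ Nat.card (HC F q) := h_points p e q hp he hq hF
  let L := MvPolynomial.restrictSupport F (hSet q m)
  have hL : ∀ f : MvPolynomial (Fin 2) F, f ∈ L ↔ MvPolynomial.degreeOf 1 f ≤ q - 1 ∧
      MvPolynomial.weightedTotalDegree ![q, q + 1] f ≤ m := by
    intro f
    rw [MvPolynomial.mem_restrictSupport_iff, MvPolynomial.degreeOf_le_iff,
      MvPolynomial.weightedTotalDegree, Finset.sup_le_iff, ← forall₂_and]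
    refine forall₂_congr fun d _ => ?_
    have h1 : d 1 < q ↔ d 1 ≤ q - 1 := by omega
    have h2 : Finsupp.weight ![q, q + 1] d = q * d 0 + (q + 1) * d 1 := by
      rw [Finsupp.weight_apply, Finsupp.sum_fintype _ _ (by simp), Fin.sum_univ_two]
      simp [mul_comm]
    rw [h2, ← h1]
    rfl
  let E : MvPolynomial (Fin 2) F →ₗ[F] (HC F q → F) :=
    { toFun := fun f P => MvPolynomial.eval ![P.1.1, P.1.2] f
      map_add' := fun f g => by funext P; simp
      map_smul' := fun c f => by funext P; simp [MvPolynomial.smul_eval] }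
  have hspan : Submodule.span F S = L.map E := by
    have : S = (L.map E : Submodule F (HC F q → F)) := by
      rw [hS]
      ext v
      constructor
      · rintro ⟨f, h1, h2, h3⟩
        exact ⟨f, (hL f).2 ⟨h1, h2⟩, funext fun P => (h3 P).symm⟩
      · rintro ⟨f, hf, rfl⟩
        exact ⟨f, ((hL f).1 hf).1, ((hL f).1 hf).2, fun P => rfl⟩
    rw [this, Submodule.span_eq]
  have hz : ∀ f ∈ L, f ≠ 0 → ∀ Z : Set (HC F q),
      (∀ P ∈ Z, E f P = 0) → Z.ncard ≤ m := by
    intro f hf hf0 Z hZ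
    exact h_zeros q hq2 f hf0 m (fun d hd => (MvPolynomial.mem_restrictSupport_iff F).1 hf hd) Z hZ
  constructor
  · have hinj : Function.Injective (E.domRestrict L) := by
      rw [← LinearMap.ker_eq_bot, LinearMap.ker_eq_bot']
      rintro ⟨f, hf⟩ h
      by_contra hne
      have hf0 : f ≠ 0 := fun h0 => hne (Subtype.ext h0)
      have := hz f hf hf0 Set.univ (fun P _ => congrFun h P)
      rw [Set.ncard_univ] at this
      omega
    rw [hspan, ← LinearMap.range_domRestrict, LinearMap.finrank_range_of_inj hinj,
      Module.finrank_eq_nat_card_basis (MvPolynomial.basisRestrictSupport F (hSet q m)),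
      h_count q m hq2 hm1]
  · intro v hv hv0
    rw [hspan] at hv
    obtain ⟨f, hf, rfl⟩ := hv
    have hf0 : f ≠ 0 := by rintro rfl; exact hv0 (map_zero E)
    have h1 := hz f hf hf0 {P | E f P ≠ 0}ᶜ (fun P hP => by simpa using hP)
    have h2 := Set.ncard_add_ncard_compl {P : HC F q | E f P ≠ 0}
    show q ^ 3 - m ≤ Set.ncard {P : HC F q | E f P ≠ 0}
    omega
end
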